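/- arXiv:2506.20565 — 8 statements merged into one kernel-verified Lean document; each statement's English description precedes it below -/
import Mathlib

section
/- Let P_1,…,P_s ∈ ℝ[X_1,…,X_n] be nonconstant polynomials with total degrees d_1,…,d_s, and suppose the polynomials have no common real zero at infinity, i.e., there is no y ∈ ℝ^n with y ≠ 0 such that for every i the degree-d_i homogeneous component of P_i vanishes at y (equivalently, the homogenizations P_i^H have no common real projective zero on the hyperplane X_0 = 0). Then there exists r > 0 such that for every ξ ∈ ℝ^s with |ξ_i| ≤ 1 for all i, every x ∈ ℝ^n satisfying P_i(x) = ξ_i for all i = 1,…,s has ‖x‖ ≤ r. (Real-number form of the theorem that the perturbed variety V_ξ is bounded over ℝ for all infinitesimal perturbations ξ.) -/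
open MvPolynomial


lemma aux_eval_smul {n d : ℕ} {p : MvPolynomial (Fin n) ℝ} (hp : p.IsHomogeneous d)
    (t : ℝ) (x : Fin n → ℝ) : eval (t • x) p = t ^ d * eval x p := by
  rw [eval_eq', eval_eq', Finset.mul_sum]
  refine Finset.sum_congr rfl fun m hm => ?_
  have h := hp.degree_eq_sum_deg_support hm
  change d = m.degree at h
  rw [Finsupp.degree_eq_sum] at h
  simp only [Pi.smul_apply, smul_eq_mul, mul_pow, Finset.prod_mul_distrib]
  rw [Finset.prod_pow_eq_pow_sum, ← h]
  ring

/-- The homogenization of `p`, as a function. -/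
noncomputable def auxG {n : ℕ} (p : MvPolynomial (Fin n) ℝ) (t : ℝ) (y : Fin n → ℝ) : ℝ :=
  ∑ j ∈ Finset.range (p.totalDegree + 1),
    t ^ (p.totalDegree - j) * eval y (homogeneousComponent j p)

lemma auxG_smul {n : ℕ} (p : MvPolynomial (Fin n) ℝ) (t : ℝ) (x : Fin n → ℝ) :
    auxG p t (t • x) = t ^ p.totalDegree * eval x p := by
  have h : eval x p = ∑ j ∈ Finset.range (p.totalDegree + 1),
      eval x (homogeneousComponent j p) := by
    rw [← map_sum, sum_homogeneousComponent]
  rw [h, Finset.mul_sum]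
  refine Finset.sum_congr rfl fun j hj => ?_
  rw [aux_eval_smul (homogeneousComponent_isHomogeneous j p),
    ← mul_assoc, ← pow_add, Nat.sub_add_cancel (Nat.lt_succ_iff.mp (Finset.mem_range.mp hj))]

lemma auxG_zero {n : ℕ} (p : MvPolynomial (Fin n) ℝ) (y : Fin n → ℝ) :
    auxG p 0 y = eval y (homogeneousComponent p.totalDegree p) := by
  unfold auxG
  rw [Finset.sum_range_succ, Finset.sum_eq_zero]
  · simp
  · intro j hj
    rw [zero_pow (Nat.sub_ne_zero_of_lt (Finset.mem_range.mp hj)), zero_mul]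

lemma auxG_continuous {n : ℕ} (p : MvPolynomial (Fin n) ℝ) :
    Continuous fun q : ℝ × (Fin n → ℝ) => auxG p q.1 q.2 := by
  unfold auxG
  refine continuous_finsetSum _ fun j _ => ?_
  exact (continuous_fst.pow _).mul ((MvPolynomial.continuous_eval _).comp continuous_snd)

/-- If the nonconstant polynomials `P 1, …, P s` have no common real zero at
infinity (no nonzero `y` annihilating all top-degree homogeneous components), then the perturbed
varieties `V_ξ` are uniformly bounded for all perturbations `ξ` with `|ξ i| ≤ 1`. -/
theorem perturbed_variety_bounded (n s : ℕ) (P : Fin s → MvPolynomial (Fin n) ℝ)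
    (hnc : ∀ i, 0 < (P i).totalDegree)
    (hinf : ∀ y : Fin n → ℝ, y ≠ 0 →
      ∃ i, eval y (homogeneousComponent (P i).totalDegree (P i)) ≠ 0) :
    ∃ r > (0 : ℝ), ∀ ξ : Fin s → ℝ, (∀ i, |ξ i| ≤ 1) →
      ∀ x : Fin n → ℝ, (∀ i, eval x (P i) = ξ i) → ‖x‖ ≤ r := by
  by_contra! H
  have H' : ∀ k : ℕ, ∃ x : Fin n → ℝ, (∀ i, |eval x (P i)| ≤ 1) ∧ (k : ℝ) + 1 < ‖x‖ := by
    intro k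
    obtain ⟨ξ, hξ, x, hx, hr⟩ := H (k + 1) (by positivity)
    exact ⟨x, fun i => by rw [hx i]; exact hξ i, hr⟩
  choose x hx hk using H'
  have hpos : ∀ k, 0 < ‖x k‖ := fun k => lt_trans (by positivity) (hk k)
  have ht : Filter.Tendsto (fun k => ‖x k‖⁻¹) Filter.atTop (nhds 0) := by
    refine squeeze_zero (fun k => by positivity) (fun k => ?_)
      (tendsto_one_div_add_atTop_nhds_zero_nat (𝕜 := ℝ))
    rw [one_div]
    exact inv_anti₀ (by positivity) (hk k).le
  have hs : ∀ k, ‖x k‖⁻¹ • x k ∈ Metric.sphere (0 : Fin n → ℝ) 1 := by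
    intro k
    rw [mem_sphere_zero_iff_norm, norm_smul, norm_inv, norm_norm, inv_mul_cancel₀ (hpos k).ne']
  obtain ⟨y, hy, φ, hφ, hlim⟩ := (isCompact_sphere (0 : Fin n → ℝ) 1).tendsto_subseq hs
  have hy0 : y ≠ 0 := by
    rintro rfl
    simp at hy
  obtain ⟨i, hi⟩ := hinf y hy0
  have htφ := ht.comp hφ.tendsto_atTop
  have h1 := ((auxG_continuous (P i)).tendsto (0, y)).comp (htφ.prodMk_nhds hlim)
  have h2 : Filter.Tendsto ((fun q : ℝ × (Fin n → ℝ) => auxG (P i) q.1 q.2) ∘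
      fun k => (((fun k => ‖x k‖⁻¹) ∘ φ) k, ((fun k => ‖x k‖⁻¹ • x k) ∘ φ) k))
      Filter.atTop (nhds 0) := by
    have h3 := htφ.pow (P i).totalDegree
    rw [zero_pow (hnc i).ne'] at h3
    refine squeeze_zero_norm (fun k => ?_) h3
    simp only [Function.comp, auxG_smul]
    rw [norm_mul, norm_pow, norm_inv, norm_norm, Real.norm_eq_abs]
    exact mul_le_of_le_one_right (by positivity) (hx _ i)
  have h4 := tendsto_nhds_unique h1 h2
  simp only [auxG_zero] at h4
  exact hi h4
end

section
/- Let F, P_1,…,P_s ∈ ℝ[X_1,…,X_n] with each P_i nonconstant. Assume: (i) the top-degree homogeneous components of P_1,…,P_s have no common real zero other than the origin; and (ii) there exists x_0 ∈ ℝ^n with P_i(x_0) = 0 for all i that is a non-singular zero of {P_1,…,P_s}. Then there exist ε ∈ (0,1] and r > 0 such that for every ξ ∈ ℝ^s with 0 < ξ_i < ε for all i: (a) V_ξ is nonempty, compact, and contained in the closed ball of radius r about the origin; and (b) if additionally every point of V_ξ is a non-singular zero of {P_1 − ξ_1,…,P_s − ξ_s}, then the set of Lagrange critical points {x ∈ ℝ^n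 : P_i(x) = ξ_i for all i, and there exists u ∈ ℝ^s with ∇F(x) = Σ_{i=1}^s u_i ∇P_i(x)} is nonempty and contained in the closed ball of radius r. (Real-number form of the corollary that Crit(V_ξ,F) is nonempty and bounded over ℝ.) -/
open MvPolynomial

open Topology

lemma aux_deriv {n : ℕ} (p : MvPolynomial (Fin n) ℝ) (x : Fin n → ℝ) :
    HasStrictFDerivAt (fun y : Fin n → ℝ => eval y p)
      (∑ j, eval x (pderiv j p) • (ContinuousLinearMap.proj j : (Fin n → ℝ) →L[ℝ] ℝ)) x := by
  induction p using MvPolynomial.induction_on with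
  | C a => simpa using hasStrictFDerivAt_const a x
  | add p q hp hq =>
    simp only [map_add, add_smul, Finset.sum_add_distrib]
    exact hp.add hq
  | mul_X p k hp =>
    have h := hp.mul (ContinuousLinearMap.proj k : (Fin n → ℝ) →L[ℝ] ℝ).hasStrictFDerivAt
    simp only [map_mul, eval_X]
    refine h.congr_fderiv ?_
    ext v
    simp [pderiv_X, Pi.single_apply, add_mul, Finset.sum_add_distrib, Finset.mul_sum, apply_ite]
    refine Finset.sum_congr rfl fun j _ => by ring

lemma aux_surj {n s : ℕ} (M : Matrix (Fin s) (Fin n) ℝ) (h : M.rank = s) (w : Fin s → ℝ) :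
    ∃ v, M.mulVec v = w := by
  have : LinearMap.range M.mulVecLin = ⊤ := by
    apply Submodule.eq_top_of_finrank_eq
    rw [← Matrix.rank, h]; simp
  obtain ⟨v, hv⟩ := LinearMap.range_eq_top.1 this w
  exact ⟨v, hv⟩

lemma aux_li {n s : ℕ} (M : Matrix (Fin s) (Fin n) ℝ) (h : M.rank = s) (w : Fin s → ℝ)
    (hw : ∀ j, ∑ i, w i * M i j = 0) : w = 0 := by
  obtain ⟨v, hv⟩ := aux_surj M h w
  have h1 : w ⬝ᵥ M.mulVec v = 0 := by
    rw [Matrix.dotProduct_mulVec]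
    have : Matrix.vecMul w M = 0 := by
      ext j; simpa [Matrix.vecMul, dotProduct] using hw j
    rw [this]; simp
  rw [hv] at h1
  exact dotProduct_self_eq_zero.1 h1

lemma aux_hom {n : ℕ} (p : MvPolynomial (Fin n) ℝ) (t : ℝ) (x : Fin n → ℝ) :
    ∑ k ∈ Finset.range (p.totalDegree + 1),
      t ^ (p.totalDegree - k) * eval (t • x) (homogeneousComponent k p)
      = t ^ p.totalDegree * eval x p := by
  have h : ∀ k, eval (t • x) (homogeneousComponent k p)
      = t ^ k * eval x (homogeneousComponent k p) := by
    intro k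
    rw [homogeneousComponent_apply]
    simp only [map_sum, Finset.mul_sum]
    refine Finset.sum_congr rfl fun d hd => ?_
    rw [← (Finset.mem_filter.1 hd).2]
    rw [eval_monomial, eval_monomial, Finsupp.prod_fintype _ _ (by simp),
      Finsupp.prod_fintype _ _ (by simp)]
    simp only [Pi.smul_apply, smul_eq_mul, mul_pow, Finset.prod_mul_distrib,
      Finset.prod_pow_eq_pow_sum, Finsupp.degree_eq_sum]
    ring
  have h2 := congrArg (eval x) (sum_homogeneousComponent p)
  rw [← h2, map_sum, Finset.mul_sum]
  refine Finset.sum_congr rfl fun k hk => ?_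
  rw [h, ← mul_assoc, ← pow_add, Nat.sub_add_cancel (by simp at hk; omega)]

lemma aux_bdd {n s : ℕ} (P : Fin s → MvPolynomial (Fin n) ℝ)
    (hnc : ∀ i, 0 < (P i).totalDegree)
    (hinf : ∀ y : Fin n → ℝ, y ≠ 0 →
      ∃ i, eval y (homogeneousComponent (P i).totalDegree (P i)) ≠ 0) :
    ∃ r : ℝ, 0 < r ∧ ∀ x : Fin n → ℝ, (∀ i, |eval x (P i)| ≤ 1) → ‖x‖ ≤ r := by
  let H : Fin s → ℝ × (Fin n → ℝ) → ℝ := fun i q =>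
    ∑ k ∈ Finset.range ((P i).totalDegree + 1),
      q.1 ^ ((P i).totalDegree - k) * eval q.2 (homogeneousComponent k (P i))
  have hH : ∀ i, Continuous (H i) := by
    intro i
    refine continuous_finset_sum _ fun k _ => ?_
    exact (continuous_fst.pow _).mul ((MvPolynomial.continuous_eval _).comp continuous_snd)
  let Z : Set (ℝ × (Fin n → ℝ)) :=
    (Set.Icc (0:ℝ) 1 ×ˢ Metric.sphere (0 : Fin n → ℝ) 1) ∩ {q | ∀ i, |H i q| ≤ q.1}
  have hZ : IsCompact Z := by
    refine (isCompact_Icc.prod (isCompact_sphere _ _)).inter_right ?_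
    simp only [Set.setOf_forall]
    exact isClosed_iInter fun i => isClosed_le (hH i).abs continuous_fst
  have hpos : ∀ q ∈ Z, 0 < q.1 := by
    rintro ⟨t, y⟩ ⟨⟨ht, hy⟩, hq⟩
    rcases ht.1.lt_or_eq with h | h
    · exact h
    exfalso
    simp only at h
    subst h
    have hy0 : y ≠ 0 := by
      rintro rfl
      simp at hy
    obtain ⟨i, hi⟩ := hinf y hy0
    have h1 := hq i
    apply hi
    have h2 : H i (0, y) = eval y (homogeneousComponent (P i).totalDegree (P i)) := by
      simp only [H, Finset.sum_range_succ]
      rw [Finset.sum_eq_zero]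
      · simp
      · intro k hk
        rw [zero_pow (by simp at hk; omega), zero_mul]
    rw [← h2]
    exact abs_nonpos_iff.1 h1
  have hmem : ∀ x : Fin n → ℝ, (∀ i, |eval x (P i)| ≤ 1) → 1 < ‖x‖ →
      (‖x‖⁻¹, ‖x‖⁻¹ • x) ∈ Z := by
    intro x hx h1
    have h0 : 0 < ‖x‖ := by linarith
    have ht0 : 0 < ‖x‖⁻¹ := inv_pos.2 h0
    have ht1 : ‖x‖⁻¹ ≤ 1 := inv_le_one_of_one_le₀ h1.le
    refine ⟨⟨⟨ht0.le, ht1⟩, ?_⟩, ?_⟩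
    · simp [norm_smul, h0.ne']
    · intro i
      simp only [H]
      rw [aux_hom, abs_mul, abs_of_pos (pow_pos ht0 _)]
      calc _ ≤ ‖x‖⁻¹ ^ (P i).totalDegree * 1 := by gcongr; exact hx i
        _ ≤ ‖x‖⁻¹ := by
          rw [mul_one]
          exact pow_le_of_le_one ht0.le ht1 (hnc i).ne'
  rcases Z.eq_empty_or_nonempty with he | hne
  · refine ⟨1, one_pos, fun x hx => ?_⟩
    by_contra! h
    have := hmem x hx h
    simp [he] at this
  · obtain ⟨q, hq, hmin⟩ := hZ.exists_isMinOn hne continuous_fst.continuousOn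
    have hq0 := hpos q hq
    refine ⟨max 1 q.1⁻¹, by positivity, fun x hx => ?_⟩
    by_contra! h
    rw [max_lt_iff] at h
    have h2 : q.1 ≤ ‖x‖⁻¹ := hmin (hmem x hx h.1)
    have h3 := inv_lt_of_inv_lt₀ hq0 h.2
    linarith

lemma aux_open {n s : ℕ} (P : Fin s → MvPolynomial (Fin n) ℝ) (x0 : Fin n → ℝ)
    (h0 : ∀ i, eval x0 (P i) = 0)
    (hr : (Matrix.of fun (i : Fin s) (j : Fin n) => eval x0 (pderiv j (P i))).rank = s) :
    ∃ δ : ℝ, 0 < δ ∧ ∀ ξ : Fin s → ℝ, ‖ξ‖ < δ → ∃ x, ∀ i, eval x (P i) = ξ i := by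
  have hd := hasStrictFDerivAt_pi.2 fun i => aux_deriv (P i) x0
  have hm := hd.map_nhds_eq_of_surj (by
    rw [LinearMap.range_eq_top]
    intro w
    obtain ⟨v, hv⟩ := aux_surj _ hr w
    refine ⟨v, ?_⟩
    rw [← hv]
    ext i
    simp [Matrix.mulVec, dotProduct])
  have h00 : (fun i => eval x0 (P i)) = 0 := funext h0
  rw [h00] at hm
  have : Set.range (fun (x : Fin n → ℝ) i => eval x (P i)) ∈ 𝓝 (0 : Fin s → ℝ) := by
    rw [← hm]; exact Filter.range_mem_map
  obtain ⟨δ, hδ, hs⟩ := Metric.mem_nhds_iff.1 this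
  refine ⟨δ, hδ, fun ξ hξ => ?_⟩
  obtain ⟨x, hx⟩ := hs (show ξ ∈ Metric.ball 0 δ by simpa using hξ)
  exact ⟨x, fun i => congrFun hx i⟩

/-- Under the no-real-zero-at-infinity condition and existence of a
non-singular zero of `{P_1,…,P_s}` on `V`, for all small positive perturbations `ξ` the
variety `V_ξ` is nonempty, compact and contained in a fixed ball; and if moreover `V_ξ` is
non-singular, the set of Lagrange critical points of `F` on `V_ξ` is nonempty and bounded. -/
theorem crit_nonempty_bounded (n s : ℕ) (F : MvPolynomial (Fin n) ℝ)
    (P : Fin s → MvPolynomial (Fin n) ℝ)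
    (hnc : ∀ i, 0 < (P i).totalDegree)
    (hinf : ∀ y : Fin n → ℝ, y ≠ 0 →
      ∃ i, eval y (homogeneousComponent (P i).totalDegree (P i)) ≠ 0)
    (hx0 : ∃ x0 : Fin n → ℝ, (∀ i, eval x0 (P i) = 0) ∧
      (Matrix.of fun (i : Fin s) (j : Fin n) => eval x0 (pderiv j (P i))).rank = s) :
    ∃ ε : ℝ, 0 < ε ∧ ε ≤ 1 ∧ ∃ r : ℝ, 0 < r ∧
      ∀ ξ : Fin s → ℝ, (∀ i, 0 < ξ i ∧ ξ i < ε) →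
        ({x : Fin n → ℝ | ∀ i, eval x (P i) = ξ i}.Nonempty ∧
          IsCompact {x : Fin n → ℝ | ∀ i, eval x (P i) = ξ i} ∧
          {x : Fin n → ℝ | ∀ i, eval x (P i) = ξ i} ⊆ Metric.closedBall 0 r) ∧
        ((∀ x : Fin n → ℝ, (∀ i, eval x (P i) = ξ i) →
            (Matrix.of fun (i : Fin s) (j : Fin n) => eval x (pderiv j (P i))).rank = s) →
          {x : Fin n → ℝ | (∀ i, eval x (P i) = ξ i) ∧ ∃ u : Fin s → ℝ,
              ∀ j, eval x (pderiv j F) = ∑ i, u i * eval x (pderiv j (P i))}.Nonempty ∧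
          {x : Fin n → ℝ | (∀ i, eval x (P i) = ξ i) ∧ ∃ u : Fin s → ℝ,
              ∀ j, eval x (pderiv j F) = ∑ i, u i * eval x (pderiv j (P i))} ⊆
            Metric.closedBall 0 r) := by
  obtain ⟨x0, h0, hr⟩ := hx0
  obtain ⟨δ, hδ, hne⟩ := aux_open P x0 h0 hr
  obtain ⟨r, hr0, hb⟩ := aux_bdd P hnc hinf
  refine ⟨min δ 1, by positivity, min_le_right _ _, r, hr0, fun ξ hξ => ?_⟩
  have hsub : {x : Fin n → ℝ | ∀ i, eval x (P i) = ξ i} ⊆ Metric.closedBall 0 r := by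
    intro x hx
    rw [mem_closedBall_zero_iff]
    refine hb x fun i => ?_
    rw [hx i, abs_of_pos (hξ i).1]
    exact ((hξ i).2.trans_le (min_le_right _ _)).le
  have hnon : {x : Fin n → ℝ | ∀ i, eval x (P i) = ξ i}.Nonempty := by
    refine hne ξ ((pi_norm_lt_iff hδ).2 fun i => ?_)
    rw [Real.norm_eq_abs, abs_of_pos (hξ i).1]
    exact (hξ i).2.trans_le (min_le_left _ _)
  have hcl : IsClosed {x : Fin n → ℝ | ∀ i, eval x (P i) = ξ i} := by
    simp only [Set.setOf_forall]
    exact isClosed_iInter fun i => isClosed_eq (MvPolynomial.continuous_eval _) continuous_const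
  have hcpt := (isCompact_closedBall (0 : Fin n → ℝ) r).of_isClosed_subset hcl hsub
  refine ⟨⟨hnon, hcpt, hsub⟩, fun hns => ⟨?_, fun x hx => hsub hx.1⟩⟩
  obtain ⟨x, hx, hmin⟩ := hcpt.exists_isMinOn hnon (MvPolynomial.continuous_eval F).continuousOn
  refine ⟨x, hx, ?_⟩
  have hset : {y : Fin n → ℝ | ∀ i, eval y (P i) = eval x (P i)}
      = {x : Fin n → ℝ | ∀ i, eval x (P i) = ξ i} := by
    ext y; exact forall_congr' fun i => by rw [hx i]
  have hext : IsLocalExtrOn (fun y => eval y F)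
      {y : Fin n → ℝ | ∀ i, eval y (P i) = eval x (P i)} x := by
    rw [hset]; exact hmin.localize.isExtr
  obtain ⟨L, L0, hL, hsum⟩ := hext.exists_multipliers_of_hasStrictFDerivAt
    (f := fun i y => eval y (P i)) (fun i => aux_deriv (P i) x) (aux_deriv F x)
  have hj : ∀ j, ∑ i, L i * eval x (pderiv j (P i)) + L0 * eval x (pderiv j F) = 0 := by
    intro j
    have := DFunLike.congr_fun hsum (Pi.single j 1)
    simpa [Pi.single_apply] using this
  have hL0 : L0 ≠ 0 := by
    rintro rfl
    apply hL
    have := aux_li _ (hns x hx) L (fun j => by simpa using hj j)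
    simp [this]
  refine ⟨fun i => -(L i / L0), fun j => ?_⟩
  have h1 : ∑ i, -(L i / L0) * eval x (pderiv j (P i))
      = -(∑ i, L i * eval x (pderiv j (P i))) / L0 := by
    rw [← Finset.sum_neg_distrib, Finset.sum_div]
    exact Finset.sum_congr rfl fun i _ => by ring
  rw [h1, eq_div_iff hL0]
  linarith [hj j]
end

section
/- Let P_1,…,P_s ∈ ℝ[X_1,…,X_n], let V = {x ∈ ℝ^n : P_i(x) = 0 for all i}, let x ∈ V, and let D be the connected component of V containing x. Assume D is bounded. Then for every α > 0 there exists ε > 0 such that for every ξ ∈ ℝ^s with 0 < ξ_i < ε for all i and every x' ∈ V_ξ with ‖x' − x‖ < ε, the connected component of V_ξ containing x' is contained in the set {y ∈ ℝ^n : there exists z ∈ D with ‖y − z‖ < α}. In particular, this component of V_ξ is bounded, uniformly for all such ξ. (Real-number form of the theorem that the component D_ξ of V_ξ through a point infinitesimally close to x is bounded over ℝ and lim_ξ(D_ξ) ⊆ D.) -/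
open MvPolynomial

theorem exists_sep {n : ℕ} (V : Set (Fin n → ℝ)) (hV : IsClosed V) (x : Fin n → ℝ) (hx : x ∈ V)
    (hD : Bornology.IsBounded (connectedComponentIn V x)) (W : Set (Fin n → ℝ)) (hW : IsOpen W)
    (hDW : connectedComponentIn V x ⊆ W) (hWb : Bornology.IsBounded W) :
    ∃ U : Set (Fin n → ℝ), IsOpen U ∧ x ∈ U ∧ U ⊆ W ∧ Disjoint (frontier U) V := by
  have hxW : x ∈ W := hDW (mem_connectedComponentIn hx)
  have hK : IsCompact (V ∩ closure W) :=
    Metric.isCompact_of_isClosed_isBounded (hV.inter isClosed_closure)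
      (hWb.closure.subset Set.inter_subset_right)
  set K := V ∩ closure W with hKdef
  have : CompactSpace K := isCompact_iff_compactSpace.1 hK
  let x0 : K := ⟨x, hx, subset_closure hxW⟩
  have hcomp : connectedComponent x0 ⊆ Subtype.val ⁻¹' W := by
    rw [← Set.image_subset_iff]
    refine subset_trans ?_ hDW
    refine IsPreconnected.subset_connectedComponentIn ?_ ⟨x0, mem_connectedComponent, rfl⟩ ?_
    · exact isPreconnected_connectedComponent.image _ continuous_subtype_val.continuousOn
    · rintro _ ⟨y, -, rfl⟩
      exact y.2.1
  rw [connectedComponent_eq_iInter_isClopen] at hcomp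
  have : Nonempty { s : Set K // IsClopen s ∧ x0 ∈ s } := ⟨⟨Set.univ, isClopen_univ, trivial⟩⟩
  obtain ⟨⟨C, hC, hxC⟩, hCW⟩ := exists_subset_nhds_of_compactSpace
    (V := fun s : { s : Set K // IsClopen s ∧ x0 ∈ s } => (s : Set K))
    (by
      rintro ⟨a, ha, hxa⟩ ⟨b, hb, hxb⟩
      exact ⟨⟨a ∩ b, ha.inter hb, hxa, hxb⟩, Set.inter_subset_left, Set.inter_subset_right⟩)
    (fun s => s.2.1.1) (U := Subtype.val ⁻¹' W)
    (fun y hy => (hW.preimage continuous_subtype_val).mem_nhds (hcomp hy))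
  have hC1 : IsClosed (Subtype.val '' C : Set (Fin n → ℝ)) :=
    (hC.1.isCompact.image continuous_subtype_val).isClosed
  have hC2 : IsClosed (Subtype.val '' Cᶜ : Set (Fin n → ℝ)) :=
    (hC.compl.1.isCompact.image continuous_subtype_val).isClosed
  have hdisj : Disjoint (Subtype.val '' C : Set (Fin n → ℝ)) (Subtype.val '' Cᶜ ∪ Wᶜ) := by
    rw [Set.disjoint_left]
    rintro _ ⟨y, hy, rfl⟩ (⟨z, hz, hzy⟩ | h)
    · exact hz (Subtype.ext hzy ▸ hy)
    · exact h (hCW hy)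
  obtain ⟨U, U', hU, hU', hCU, hBU, hd⟩ :=
    normal_separation hC1 (hC2.union hW.isClosed_compl) hdisj
  refine ⟨U, hU, hCU ⟨x0, hxC, rfl⟩, fun y hy => ?_, ?_⟩
  · by_contra h
    exact Set.disjoint_left.1 hd hy (hBU (Or.inr h))
  · rw [Set.disjoint_left]
    intro p hp hpV
    rw [hU.frontier_eq] at hp
    have hpU' : p ∉ U' := Set.disjoint_left.1 (hd.closure_left hU') hp.1
    have hpW : p ∈ W := by
      by_contra h
      exact hpU' (hBU (Or.inr h))
    by_cases hpc : (⟨p, hpV, subset_closure hpW⟩ : K) ∈ C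
    · exact hp.2 (hCU ⟨_, hpc, rfl⟩)
    · exact hpU' (hBU (Or.inl ⟨_, hpc, rfl⟩))

/-- If the connected component `D` of `V = {P_i = 0}` containing `x` is
bounded, then for small positive `ξ`, the connected component of `V_ξ` through any point
close to `x` lies in any prescribed `α`-neighborhood of `D` (in particular it is bounded,
uniformly in `ξ`). -/
theorem perturbed_component_bounded (n s : ℕ) (P : Fin s → MvPolynomial (Fin n) ℝ)
    (x : Fin n → ℝ) (hx : ∀ i, eval x (P i) = 0)
    (hD : Bornology.IsBounded
      (connectedComponentIn {y : Fin n → ℝ | ∀ i, eval y (P i) = 0} x)) :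
    ∀ α : ℝ, 0 < α → ∃ ε : ℝ, 0 < ε ∧
      ∀ ξ : Fin s → ℝ, (∀ i, 0 < ξ i ∧ ξ i < ε) →
        ∀ x' : Fin n → ℝ, (∀ i, eval x' (P i) = ξ i) → ‖x' - x‖ < ε →
          connectedComponentIn {y : Fin n → ℝ | ∀ i, eval y (P i) = ξ i} x' ⊆
              {y : Fin n → ℝ |
                ∃ z ∈ connectedComponentIn {w : Fin n → ℝ | ∀ i, eval w (P i) = 0} x,
                  ‖y - z‖ < α} ∧
            Bornology.IsBounded
              (connectedComponentIn {y : Fin n → ℝ | ∀ i, eval y (P i) = ξ i} x') := by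
  intro α hα
  set V : Set (Fin n → ℝ) := {y | ∀ i, eval y (P i) = 0} with hV
  set D := connectedComponentIn V x with hDdef
  have hxV : x ∈ V := hx
  have hFc : Continuous (fun (y : Fin n → ℝ) (i : Fin s) => eval y (P i)) :=
    continuous_pi fun i => MvPolynomial.continuous_eval (P i)
  have hVF : V = (fun (y : Fin n → ℝ) (i : Fin s) => eval y (P i)) ⁻¹' {0} := by
    ext y; simp [hV, funext_iff]
  have hVc : IsClosed V := by
    rw [hVF]; exact isClosed_singleton.preimage hFc
  obtain ⟨U, hUo, hxU, hUW, hUV⟩ := exists_sep V hVc x hxV hD (Metric.thickening α D)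
    Metric.isOpen_thickening (Metric.self_subset_thickening hα _) hD.thickening
  have hUb : Bornology.IsBounded U := (hD.thickening (δ := α)).subset hUW
  have hcpt : IsCompact (frontier U) :=
    Metric.isCompact_of_isClosed_isBounded isClosed_frontier
      (hUb.closure.subset frontier_subset_closure)
  have h0 : (0 : Fin s → ℝ) ∈ ((fun (y : Fin n → ℝ) (i : Fin s) => eval y (P i)) '' frontier U)ᶜ := by
    rintro ⟨y, hy, hy0⟩
    have : y ∈ V := by rw [hVF]; exact hy0
    exact Set.disjoint_left.1 hUV hy this
  obtain ⟨e1, he1, hb1⟩ := Metric.isOpen_iff.1 (hcpt.image hFc).isClosed.isOpen_compl 0 h0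
  obtain ⟨e2, he2, hb2⟩ := Metric.isOpen_iff.1 hUo x hxU
  refine ⟨min e1 e2, lt_min he1 he2, fun ξ hξ x' hx' hxx => ?_⟩
  have hsub : connectedComponentIn {y : Fin n → ℝ | ∀ i, eval y (P i) = ξ i} x' ⊆ U := by
    have hx'U : x' ∈ U := hb2 (by
      rw [Metric.mem_ball, dist_eq_norm]; exact hxx.trans_le (min_le_right _ _))
    intro y hy
    by_contra hyU
    obtain ⟨z, hz, hzf⟩ : ∃ z ∈ connectedComponentIn
        {y : Fin n → ℝ | ∀ i, eval y (P i) = ξ i} x', z ∈ frontier U := by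
      by_contra hno
      push Not at hno
      have hcl : ∀ z ∈ connectedComponentIn {y : Fin n → ℝ | ∀ i, eval y (P i) = ξ i} x',
          z ∉ U → z ∈ (closure U)ᶜ := by
        intro z hz hzU hzc
        refine hno z hz ?_
        rw [hUo.frontier_eq]
        exact ⟨hzc, hzU⟩
      obtain ⟨w, -, hw1, hw2⟩ := (isPreconnected_connectedComponentIn
          (F := {y : Fin n → ℝ | ∀ i, eval y (P i) = ξ i}) (x := x')) U (closure U)ᶜ hUo
        isClosed_closure.isOpen_compl
        (fun z hz => (Classical.em (z ∈ U)).imp id (hcl z hz))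
        ⟨x', mem_connectedComponentIn hx', hx'U⟩ ⟨y, hy, hcl y hy hyU⟩
      exact hw2 (subset_closure hw1)
    have hzV := connectedComponentIn_subset _ _ hz
    refine hb1 (a := ξ) ?_ ⟨z, hzf, funext hzV⟩
    rw [mem_ball_zero_iff, pi_norm_lt_iff he1]
    intro i
    rw [Real.norm_of_nonneg (hξ i).1.le]
    exact (hξ i).2.trans_le (min_le_left _ _)
  refine ⟨fun y hy => ?_, hUb.subset hsub⟩
  obtain ⟨z, hz, hd⟩ := Metric.mem_thickening_iff.1 (hUW (hsub hy))
  exact ⟨z, hz, by rwa [← dist_eq_norm]⟩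
end

section
/- Let F, P ∈ ℝ[X_1,…,X_n] with P nonconstant. Suppose there exists c ∈ ℂ such that the set of complex projective KKT points of F on {P = c} is finite (as a subset of ℙ^n(ℂ) × ℙ^1(ℂ)). Then there exists a finite set E ⊆ ℝ such that for every ξ ∈ ℝ ∖ E, the set {x ∈ ℝ^n : P(x) = ξ and there exists u ∈ ℝ with ∇F(x) = u·∇P(x)} is finite. (Real-number form of the theorem that Crit(V_ξ,F) is finite.) -/
open MvPolynomial

/-- The homogenization `Q^H ∈ ℂ[X_0,…,X_n]` of `Q ∈ ℂ[X_1,…,X_n]`: the unique homogeneous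
polynomial of degree `deg Q` with `Q^H(1,X_1,…,X_n) = Q` (and `0^H = 0`). Variable `0` of
`Fin (n+1)` is the homogenizing variable `X_0`. -/
noncomputable def homogenizeC {n : ℕ} (Q : MvPolynomial (Fin n) ℂ) :
    MvPolynomial (Fin (n + 1)) ℂ :=
  ∑ m ∈ Q.support,
    monomial
      (Finsupp.mapDomain Fin.succ m +
        Finsupp.single (0 : Fin (n + 1)) (Q.totalDegree - m.sum fun _ e => e))
      (coeff m Q)

/-- A real polynomial viewed as a complex polynomial. -/
noncomputable def toComplex {n : ℕ} (Q : MvPolynomial (Fin n) ℝ) : MvPolynomial (Fin n) ℂ :=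
  map (algebraMap ℝ ℂ) Q

/-- The bi-homogeneous polynomial
`H_j = U_0·X_0^{m_j−a_j}·(∂F/∂X_j)^H − U_1·X_0^{m_j−b_j}·(∂P/∂X_j)^H`, an element of
`ℂ[X_0,…,X_n,U_0,U_1]` (variables indexed by `Fin (n+1) ⊕ Fin 2`). -/
noncomputable def kktH {n : ℕ} (F P : MvPolynomial (Fin n) ℝ) (j : Fin n) :
    MvPolynomial (Fin (n + 1) ⊕ Fin 2) ℂ :=
  X (Sum.inr 0) *
      X (Sum.inl 0) ^ (max (pderiv j F).totalDegree (pderiv j P).totalDegree -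
        (pderiv j F).totalDegree) *
      rename Sum.inl (homogenizeC (toComplex (pderiv j F))) -
    X (Sum.inr 1) *
      X (Sum.inl 0) ^ (max (pderiv j F).totalDegree (pderiv j P).totalDegree -
        (pderiv j P).totalDegree) *
      rename Sum.inl (homogenizeC (toComplex (pderiv j P)))

/-- The homogeneous polynomial `H_0 = P^H − c·X_0^{deg P}` in `ℂ[X_0,…,X_n,U_0,U_1]`. -/
noncomputable def kktH0 {n : ℕ} (P : MvPolynomial (Fin n) ℝ) (c : ℂ) :
    MvPolynomial (Fin (n + 1) ⊕ Fin 2) ℂ :=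
  rename Sum.inl (homogenizeC (toComplex P)) - C c * X (Sum.inl 0) ^ P.totalDegree

/-- The set of complex projective KKT points of `F` on `{P = c}`, as a subset of
`ℙ^n(ℂ) × ℙ^1(ℂ)`. -/
def projKKT {n : ℕ} (F P : MvPolynomial (Fin n) ℝ) (c : ℂ) :
    Set (Projectivization ℂ (Fin (n + 1) → ℂ) × Projectivization ℂ (Fin 2 → ℂ)) :=
  {p | ∃ (x : Fin (n + 1) → ℂ) (u : Fin 2 → ℂ) (hx : x ≠ 0) (hu : u ≠ 0),
    p = (Projectivization.mk ℂ x hx, Projectivization.mk ℂ u hu) ∧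
    (∀ j : Fin n, eval (Sum.elim x u) (kktH F P j) = 0) ∧
    eval (Sum.elim x u) (kktH0 P c) = 0}


lemma aux_span_bound {R : Type*} [CommRing R] [Algebra ℂ R] (V : ℕ → Submodule ℂ R) (g l : R)
    (d K : ℕ) (hd : 0 < d) (W : Finset R)
    (hW : ∀ r < K, V r ≤ Submodule.span ℂ (W : Set R))
    (hstep : ∀ k, K ≤ k → ∀ v ∈ V k, ∃ w z, v = g * w + l * z ∧
      (w = 0 ∨ ∃ k', k' + d = k ∧ w ∈ V k') ∧ (z = 0 ∨ ∃ k', k' + 1 = k ∧ z ∈ V k')) (k : ℕ) :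
    V k ≤ Submodule.span ℂ {y : R | ∃ a b r, r < K ∧ d * a + b + r = k ∧ ∃ w ∈ W,
      y = g ^ a * l ^ b * w} := by
  induction k using Nat.strong_induction_on with
  | _ k ih =>
  by_cases hk : k < K
  · refine (hW k hk).trans (Submodule.span_mono ?_)
    intro w hw
    exact ⟨0, 0, k, hk, by simp, w, hw, by simp⟩
  · push Not at hk
    intro v hv
    obtain ⟨w, z, rfl, hw, hz⟩ := hstep k hk v hv
    refine Submodule.add_mem _ ?_ ?_
    · rcases hw with rfl | ⟨k', hk', hw⟩
      · simp
      · have h1 := ih k' (by omega) hw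
        have h2 := Submodule.mem_map_of_mem (f := LinearMap.mulLeft ℂ g) h1
        rw [Submodule.map_span] at h2
        refine Submodule.span_mono ?_ h2
        rintro _ ⟨y, ⟨a, b, r, hr, hab, w, hw, rfl⟩, rfl⟩
        refine ⟨a + 1, b, r, hr, by rw [← hk', ← hab]; ring, w, hw, ?_⟩
        simp only [LinearMap.mulLeft_apply]
        ring
    · rcases hz with rfl | ⟨k', hk', hw⟩
      · simp
      · have h1 := ih k' (by omega) hw
        have h2 := Submodule.mem_map_of_mem (f := LinearMap.mulLeft ℂ l) h1
        rw [Submodule.map_span] at h2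
        refine Submodule.span_mono ?_ h2
        rintro _ ⟨y, ⟨a, b, r, hr, hab, w, hw, rfl⟩, rfl⟩
        refine ⟨a, b + 1, r, hr, by rw [← hk', ← hab]; ring, w, hw, ?_⟩
        simp only [LinearMap.mulLeft_apply]
        ring

lemma aux_count {R : Type*} [CommRing R] [Algebra ℂ R] (V : ℕ → Submodule ℂ R) (g l p x : R)
    (d K : ℕ) (hd : 0 < d) (W : Finset R)
    (hW : ∀ r < K, V r ≤ Submodule.span ℂ (W : Set R))
    (hstep : ∀ k, K ≤ k → ∀ v ∈ V k, ∃ w z, v = g * w + l * z ∧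
      (w = 0 ∨ ∃ k', k' + d = k ∧ w ∈ V k') ∧ (z = 0 ∨ ∃ k', k' + 1 = k ∧ z ∈ V k'))
    (hmem : ∀ k a b, d * a + b ≤ k → p ^ a * x ^ b ∈ V k)
    (hli : ∀ m : ℕ, LinearIndependent ℂ
      (fun ab : Fin (m + 1) × Fin (m + 1) => p ^ (ab.1 : ℕ) * x ^ (ab.2 : ℕ))) : False := by
  classical
  set C := K * W.card with hC
  set m := (d + 1) * C with hm
  set k := (d + 1) * m with hk
  set A : Finset R := ((Finset.range (k + 1)) ×ˢ (Finset.range K) ×ˢ W).image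
    (fun q => g ^ q.1 * l ^ (k - d * q.1 - q.2.1) * q.2.2) with hA
  have hcard : A.card ≤ (k + 1) * C := by
    refine Finset.card_image_le.trans ?_
    simp [hC]
  have hspan : V k ≤ Submodule.span ℂ (A : Set R) := by
    refine (aux_span_bound V g l d K hd W hW hstep k).trans (Submodule.span_mono ?_)
    rintro _ ⟨a, b, r, hr, hab, w, hw, rfl⟩
    rw [hA]
    simp only [Finset.coe_image, Set.mem_image, Finset.mem_coe, Finset.mem_product,
      Finset.mem_range]
    refine ⟨(a, r, w), ⟨?_, hr, hw⟩, ?_⟩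
    · have : a ≤ d * a := Nat.le_mul_of_pos_left a hd
      omega
    · have : k - d * a - r = b := by omega
      simp [this]
  have h := linearIndependent_le_span' _ (hli m) (A : Set R) (by
    rintro _ ⟨⟨a, b⟩, rfl⟩
    apply hspan
    apply hmem
    have ha := a.2
    have hb := b.2
    have : d * (a : ℕ) ≤ d * m := Nat.mul_le_mul_left d (by omega)
    have h3 : k = d * m + m := by rw [hk]; ring
    simp only
    omega)
  simp only [Cardinal.mk_prod, Cardinal.mk_fin, Cardinal.lift_natCast, Finset.coe_sort_coe,
    Fintype.card_coe] at h
  have h' : (m + 1) * (m + 1) ≤ A.card := by exact_mod_cast h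
  have h4 : (k + 1) * C ≤ (m + 1) * m := by
    calc (k + 1) * C ≤ ((d + 1) * m + (d + 1)) * C := by gcongr; omega
      _ = (m + 1) * ((d + 1) * C) := by ring
      _ = (m + 1) * m := by rw [← hm]
  nlinarith

lemma aux_li_s4 {S : Type*} (p x : S → ℂ) (E : Set ℂ) (hE : E.Infinite)
    (h : ∀ ξ ∈ E, (x '' {s | p s = ξ}).Infinite) (m : ℕ) :
    LinearIndependent ℂ
      (fun ab : Fin (m + 1) × Fin (m + 1) => p ^ (ab.1 : ℕ) * x ^ (ab.2 : ℕ)) := by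
  rw [Fintype.linearIndependent_iff]
  intro c hc
  have key : ∀ (f : Fin (m + 1) → ℂ) (T : Set ℂ), T.Infinite →
      (∀ t ∈ T, ∑ i, f i * t ^ (i : ℕ) = 0) → ∀ i, f i = 0 := by
    intro f T hT hf i
    have h0 : (∑ i : Fin (m + 1), Polynomial.C (f i) * Polynomial.X ^ (i : ℕ)) = 0 := by
      apply Polynomial.eq_zero_of_infinite_isRoot
      refine hT.mono ?_
      intro t ht
      simp only [Set.mem_ofPred_eq, Polynomial.IsRoot.def, Polynomial.eval_finsetSum,
        Polynomial.eval_mul, Polynomial.eval_C, Polynomial.eval_pow, Polynomial.eval_X]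
      exact hf t ht
    have h1 := congrArg (fun q => Polynomial.coeff q (i : ℕ)) h0
    simpa [Polynomial.finsetSum_coeff, Polynomial.coeff_C_mul, Polynomial.coeff_X_pow,
      Fin.val_inj] using h1
  rintro ⟨a, b⟩
  refine key (fun a => c (a, b)) E hE ?_ a
  intro ξ hξ
  refine key (fun b => ∑ a, c (a, b) * ξ ^ (a : ℕ)) _ (h ξ hξ) ?_ b
  rintro _ ⟨s, hs, rfl⟩
  have h2 := congrFun hc s
  simp only [Finset.sum_apply, Pi.smul_apply, Pi.mul_apply, Pi.pow_apply, smul_eq_mul,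
    Pi.zero_apply, Fintype.sum_prod_type] at h2
  rw [← h2, Finset.sum_comm]
  refine Finset.sum_congr rfl fun b _ => ?_
  rw [Finset.sum_mul]
  refine Finset.sum_congr rfl fun a _ => ?_
  rw [show p s = ξ from hs]
  ring

/-- bi-degree weights -/
def aux_w (n : ℕ) : Fin (n + 1) ⊕ Fin 2 → ℕ × ℕ := Sum.elim (fun _ => (1, 0)) (fun _ => (0, 1))

lemma aux_weight (n : ℕ) (s : (Fin (n + 1) ⊕ Fin 2) →₀ ℕ) :
    Finsupp.weight (aux_w n) s = (∑ i, s (Sum.inl i), ∑ j, s (Sum.inr j)) := by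
  rw [Finsupp.weight_apply, Finsupp.sum_fintype _ _ (by simp), Fintype.sum_sum_type]
  ext <;> simp [aux_w, Prod.fst_sum, Prod.snd_sum]

lemma aux_comp_mul {σ : Type*} (w : σ → ℕ × ℕ) (a h : MvPolynomial σ ℂ) (e i j : ℕ × ℕ)
    (hh : IsWeightedHomogeneous w h j) (he : i + j = e) :
    weightedHomogeneousComponent w e (a * h) = weightedHomogeneousComponent w i a * h := by
  classical
  let _i := weightedGradedAlgebra ℂ w
  have := DirectSum.coe_decompose_mul_add_of_right_mem (weightedHomogeneousSubmodule ℂ w)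
    (i := i) (j := j) (a := a) (b := h) hh
  rw [he] at this
  have e1 := weightedDecomposition.decompose'_apply ℂ w (a * h) e
  have e2 := weightedDecomposition.decompose'_apply ℂ w a i
  rw [← e1, ← e2]
  exact this

lemma aux_comp_mul_not {σ : Type*} (w : σ → ℕ × ℕ) (a h : MvPolynomial σ ℂ) (e j : ℕ × ℕ)
    (hh : IsWeightedHomogeneous w h j) (he : ¬ j ≤ e) :
    weightedHomogeneousComponent w e (a * h) = 0 := by
  classical
  let _i := weightedGradedAlgebra ℂ w
  have := DirectSum.coe_decompose_mul_of_right_mem_of_not_le (weightedHomogeneousSubmodule ℂ w)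
    (a := a) (b := h) hh he
  have e1 := weightedDecomposition.decompose'_apply ℂ w (a * h) e
  rw [← e1]
  exact this

lemma aux_comp_span {σ ι : Type*} (w : σ → ℕ × ℕ) (H : ι → MvPolynomial σ ℂ) (j : ι → ℕ × ℕ)
    (hH : ∀ i, IsWeightedHomogeneous w (H i) (j i)) (e : ℕ × ℕ) (z : MvPolynomial σ ℂ)
    (hz : z ∈ Ideal.span (Set.range H)) :
    weightedHomogeneousComponent w e z ∈ Ideal.span (Set.range H) := by
  classical
  let _i := weightedGradedAlgebra ℂ w
  refine weightedHomogeneousComponent_mem_of_mem ℂ w ?_ hz e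
  apply Ideal.homogeneous_span
  rintro _ ⟨i, rfl⟩
  exact ⟨j i, hH i⟩

lemma aux_fg (n : ℕ) (e : ℕ × ℕ) : (weightedHomogeneousSubmodule ℂ (aux_w n) e).FG := by
  have h := weightedHomogeneousSubmodule_fg ℂ (σ := Fin (n + 1) ⊕ Fin 2) (fun _ => 1)
    (by simp) (e.1 + e.2)
  refine Submodule.FG.of_le h ?_
  intro f hf s hs
  have := hf hs
  rw [aux_weight] at this
  rw [Finsupp.weight_apply, Finsupp.sum_fintype _ _ (by simp), Fintype.sum_sum_type]
  simp [← this]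

/-- large bidegree polynomials are in the ideal -/
lemma aux_large (n M : ℕ) (J : Ideal (MvPolynomial (Fin (n + 1) ⊕ Fin 2) ℂ))
    (hJ : ∀ i j, (X (Sum.inl i) * X (Sum.inr j)) ^ M ∈ J) (k : ℕ)
    (hk : (n + 1) * M ≤ k) (f : MvPolynomial (Fin (n + 1) ⊕ Fin 2) ℂ)
    (hf : IsWeightedHomogeneous (aux_w n) f (k, 2 * M)) : f ∈ J := by
  rw [f.as_sum]
  refine Ideal.sum_mem _ fun s hs => ?_
  have hw := hf (mem_support_iff.mp hs)
  rw [aux_weight, Prod.mk.injEq] at hw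
  have h1 : ∃ i, M ≤ s (Sum.inl i) := by
    by_contra! hcon
    have := Finset.sum_lt_sum_of_nonempty (s := (Finset.univ : Finset (Fin (n + 1))))
      Finset.univ_nonempty (fun i _ => hcon i)
    simp at this
    omega
  have h2 : ∃ i, M ≤ s (Sum.inr i) := by
    by_contra! hcon
    have := Finset.sum_lt_sum_of_nonempty (s := (Finset.univ : Finset (Fin 2)))
      Finset.univ_nonempty (fun i _ => hcon i)
    simp only [hw.2] at this
    simp at this
  obtain ⟨i, hi⟩ := h1
  obtain ⟨j, hj⟩ := h2
  refine J.mem_of_dvd ?_ (hJ i j)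
  rw [mul_pow, X_pow_eq_monomial, X_pow_eq_monomial, monomial_mul, monomial_dvd_monomial]
  refine ⟨Or.inr ?_, by simp⟩
  intro t
  rcases t with t | t
  · by_cases h : i = t <;> simp_all
  · by_cases h : j = t <;> simp_all

lemma aux_homogenize_hom {n : ℕ} (Q : MvPolynomial (Fin n) ℂ) :
    IsWeightedHomogeneous (aux_w n) (rename Sum.inl (homogenizeC Q)) (Q.totalDegree, 0) := by
  unfold homogenizeC
  rw [map_sum]
  refine IsWeightedHomogeneous.sum _ _ _ fun m hm => ?_
  rw [rename_monomial]
  apply isWeightedHomogeneous_monomial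
  have hle := le_totalDegree hm
  rw [Finsupp.mapDomain_add, map_add, Finsupp.mapDomain_single, ← Finsupp.mapDomain_comp]
  rw [Finsupp.weight_single, Finsupp.weight_apply, Finsupp.sum_mapDomain_index (by simp)
    (by intros; rw [add_smul])]
  ext
  · simp [aux_w, Finsupp.sum, Prod.fst_sum] at hle ⊢
    omega
  · simp [aux_w, Finsupp.sum, Prod.snd_sum]

lemma aux_homogenize_eval {n : ℕ} (Q : MvPolynomial (Fin n) ℂ) (x : Fin n → ℂ) :
    eval (Fin.cons 1 x : Fin (n + 1) → ℂ) (homogenizeC Q) = eval x Q := by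
  unfold homogenizeC
  conv_rhs => rw [Q.as_sum]
  rw [map_sum, map_sum]
  refine Finset.sum_congr rfl fun m hm => ?_
  rw [eval_monomial, eval_monomial, Finsupp.prod_add_index (by simp) (by intros; rw [pow_add]),
    Finsupp.prod_mapDomain_index (by simp) (by intros; rw [pow_add]),
    Finsupp.prod_single_index (by simp)]
  simp

lemma aux_toComplex_deg {n : ℕ} (Q : MvPolynomial (Fin n) ℝ) :
    (toComplex Q).totalDegree = Q.totalDegree := by
  unfold toComplex totalDegree
  rw [support_map_of_injective _ (algebraMap ℝ ℂ).injective]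

lemma aux_toComplex_eval {n : ℕ} (Q : MvPolynomial (Fin n) ℝ) (x : Fin n → ℝ) :
    eval (fun i => (x i : ℂ)) (toComplex Q) = (eval x Q : ℝ) := by
  unfold toComplex
  rw [eval_map, ← Complex.coe_algebraMap, eval₂_eq_eval_map]
  exact (map_eval (algebraMap ℝ ℂ) x Q).symm ▸ rfl

lemma aux_cast {σ : Type*} {w : σ → ℕ × ℕ} {f : MvPolynomial σ ℂ} {a b : ℕ × ℕ}
    (h : IsWeightedHomogeneous w f a) (hab : a = b) : IsWeightedHomogeneous w f b := hab ▸ h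

lemma aux_kktH_hom {n : ℕ} (F P : MvPolynomial (Fin n) ℝ) (j : Fin n) :
    IsWeightedHomogeneous (aux_w n) (kktH F P j)
      (max (pderiv j F).totalDegree (pderiv j P).totalDegree, 1) := by
  unfold kktH
  have hX : ∀ i, IsWeightedHomogeneous (aux_w n) (X i : MvPolynomial _ ℂ) (aux_w n i) :=
    fun i => isWeightedHomogeneous_X _ _ i
  apply IsWeightedHomogeneous.sub
  · have := ((hX (Sum.inr 0)).mul ((hX (Sum.inl 0)).pow
      (max (pderiv j F).totalDegree (pderiv j P).totalDegree -
        (pderiv j F).totalDegree))).mul (aux_homogenize_hom (toComplex (pderiv j F)))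
    refine aux_cast this ?_
    rw [aux_toComplex_deg]
    simp [aux_w]
  · have := ((hX (Sum.inr 1)).mul ((hX (Sum.inl 0)).pow
      (max (pderiv j F).totalDegree (pderiv j P).totalDegree -
        (pderiv j P).totalDegree))).mul (aux_homogenize_hom (toComplex (pderiv j P)))
    refine aux_cast this ?_
    rw [aux_toComplex_deg]
    simp [aux_w]

lemma aux_kktH0_hom {n : ℕ} (P : MvPolynomial (Fin n) ℝ) (c : ℂ) :
    IsWeightedHomogeneous (aux_w n) (kktH0 P c) (P.totalDegree, 0) := by
  unfold kktH0
  have hX : ∀ i, IsWeightedHomogeneous (aux_w n) (X i : MvPolynomial _ ℂ) (aux_w n i) :=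
    fun i => isWeightedHomogeneous_X _ _ i
  apply IsWeightedHomogeneous.sub
  · have := aux_homogenize_hom (toComplex P)
    rwa [aux_toComplex_deg] at this
  · have := ((hX (Sum.inl 0)).pow P.totalDegree).C_mul c
    refine aux_cast this ?_
    simp [aux_w]

/-- affine real KKT pairs -/
def AuxS {n : ℕ} (F P : MvPolynomial (Fin n) ℝ) : Type :=
  {q : (Fin n → ℝ) × ℝ // ∀ j, eval q.1 (pderiv j F) = q.2 * eval q.1 (pderiv j P)}

/-- the complex point attached to a pair -/
noncomputable def auxPt {n : ℕ} {F P : MvPolynomial (Fin n) ℝ} (q : AuxS F P) :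
    Fin (n + 1) ⊕ Fin 2 → ℂ :=
  Sum.elim (Fin.cons 1 (fun i => (q.1.1 i : ℂ))) ![1, (q.1.2 : ℂ)]

/-- evaluation -/
noncomputable def auxEv {n : ℕ} (F P : MvPolynomial (Fin n) ℝ) :
    MvPolynomial (Fin (n + 1) ⊕ Fin 2) ℂ →ₐ[ℂ] (AuxS F P → ℂ) :=
  aeval (fun i q => auxPt q i)

lemma auxEv_apply {n : ℕ} (F P : MvPolynomial (Fin n) ℝ) (f) (q : AuxS F P) :
    auxEv F P f q = eval (auxPt q) f := by
  have : ((Pi.evalAlgHom ℂ (fun _ : AuxS F P => ℂ) q).comp (auxEv F P)) =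
      aeval (auxPt q) := by
    ext i
    simp [auxEv]
  have h := DFunLike.congr_fun this f
  simpa [aeval_eq_eval] using h

lemma aux_eval_hom {n : ℕ} {F P : MvPolynomial (Fin n) ℝ} (q : AuxS F P)
    (Q : MvPolynomial (Fin n) ℝ) :
    eval (auxPt q) (rename Sum.inl (homogenizeC (toComplex Q))) = (eval q.1.1 Q : ℝ) := by
  rw [eval_rename, ← aux_toComplex_eval, ← aux_homogenize_eval (toComplex Q)]
  rfl

lemma auxEv_kktH {n : ℕ} (F P : MvPolynomial (Fin n) ℝ) (j : Fin n) :
    auxEv F P (kktH F P j) = 0 := by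
  funext q
  rw [auxEv_apply, kktH]
  simp only [map_sub, map_mul, map_pow, aux_eval_hom, eval_X, q.2 j]
  simp [auxPt]

lemma auxEv_span {n : ℕ} (F P : MvPolynomial (Fin n) ℝ) (z)
    (hz : z ∈ Ideal.span (Set.range (kktH F P))) : auxEv F P z = 0 := by
  have : Ideal.span (Set.range (kktH F P)) ≤ RingHom.ker (auxEv F P) := by
    rw [Ideal.span_le]
    rintro _ ⟨j, rfl⟩
    exact auxEv_kktH F P j
  exact this hz

lemma aux_linear {n : ℕ} (F P : MvPolynomial (Fin n) ℝ) (c : ℂ) (h : (projKKT F P c).Finite) :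
    ∃ L : MvPolynomial (Fin (n + 1) ⊕ Fin 2) ℂ, IsWeightedHomogeneous (aux_w n) L (1, 0) ∧
      ∀ (x : Fin (n + 1) → ℂ) (u : Fin 2 → ℂ), x ≠ 0 → u ≠ 0 →
        (∀ j : Fin n, eval (Sum.elim x u) (kktH F P j) = 0) →
        eval (Sum.elim x u) (kktH0 P c) = 0 → eval (Sum.elim x u) L ≠ 0 := by
  have : Finite (projKKT F P c) := h
  obtain ⟨φ, hφ⟩ := Module.exists_dual_forall_apply_ne_zero (K := ℂ)
    (fun p : projKKT F P c => p.1.1.rep) (fun p => p.1.1.rep_nonzero)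
  refine ⟨∑ i, C (φ (Pi.single i 1)) * X (Sum.inl i), ?_, ?_⟩
  · refine IsWeightedHomogeneous.sum _ _ _ fun i _ => ?_
    exact (isWeightedHomogeneous_X ℂ (aux_w n) (Sum.inl i)).C_mul _
  · intro x u hx hu h1 h2
    have h3 := hφ ⟨(Projectivization.mk ℂ x hx, Projectivization.mk ℂ u hu),
      x, u, hx, hu, rfl, h1, h2⟩
    have h4 : eval (Sum.elim x u) (∑ i, C (φ (Pi.single i 1)) * X (Sum.inl i)) = φ x := by
      rw [LinearMap.pi_apply_eq_sum_univ φ x]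
      simp [mul_comm, ← Pi.single_apply]
      refine Finset.sum_congr rfl fun i _ => ?_
      congr 2
      funext j
      simp [Pi.single_apply, eq_comm]
    rw [h4]
    obtain ⟨a, ha⟩ := Projectivization.exists_smul_eq_mk_rep ℂ x hx
    simp only at h3
    rw [← ha] at h3
    intro h0
    apply h3
    rw [Units.smul_def, map_smul, h0, smul_zero]

lemma aux_nulls {n : ℕ} (J : Ideal (MvPolynomial (Fin (n + 1) ⊕ Fin 2) ℂ))
    (hJ : ∀ (x : Fin (n + 1) → ℂ) (u : Fin 2 → ℂ), (∀ p ∈ J, eval (Sum.elim x u) p = 0) →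
      x = 0 ∨ u = 0) :
    ∃ M, ∀ i j, (X (Sum.inl i) * X (Sum.inr j)) ^ M ∈ J := by
  have h : ∀ ij : Fin (n + 1) × Fin 2, ∃ M, (X (Sum.inl ij.1) * X (Sum.inr ij.2)) ^ M ∈ J := by
    rintro ⟨i, j⟩
    have : (X (Sum.inl i) * X (Sum.inr j) : MvPolynomial _ ℂ) ∈ J.radical := by
      rw [← vanishingIdeal_zeroLocus_eq_radical (K := ℂ), mem_vanishingIdeal_iff]
      intro y hy
      rw [mem_zeroLocus_iff] at hy
      have := hJ (y ∘ Sum.inl) (y ∘ Sum.inr) (by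
        intro p hp
        rw [Sum.elim_comp_inl_inr]
        simpa [aeval_eq_eval] using hy p hp)
      rcases this with h | h
      · have := congrFun h i
        simp at this
        simp [this]
      · have := congrFun h j
        simp at this
        simp [this]
    exact this
  choose M hM using h
  refine ⟨∑ ij, M ij, fun i j => ?_⟩
  exact J.pow_mem_of_pow_mem (hM (i, j))
    (Finset.single_le_sum (f := M) (fun _ _ => Nat.zero_le _) (Finset.mem_univ (i, j)))

lemma aux_main {n : ℕ} (F P : MvPolynomial (Fin n) ℝ) (hP : 0 < P.totalDegree)
    (c : ℂ) (hfin : (projKKT F P c).Finite) (i : Fin n) (E : Set ℝ) (hE : E.Infinite)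
    (h : ∀ ξ ∈ E, ((fun x : Fin n → ℝ => x i) '' {x : Fin n → ℝ | eval x P = ξ ∧
        ∃ u : ℝ, ∀ j, eval x (pderiv j F) = u * eval x (pderiv j P)}).Infinite) : False := by
  classical
  obtain ⟨L, hLh, hL⟩ := aux_linear F P c hfin
  set J := Ideal.span (insert L (insert (kktH0 P c) (Set.range (kktH F P)))) with hJdef
  obtain ⟨M, hM⟩ := aux_nulls J (by
    intro x u hp
    by_contra! hxu
    refine hL x u hxu.1 hxu.2 (fun j => hp _ (Ideal.subset_span ?_))
      (hp _ (Ideal.subset_span ?_)) (hp _ (Ideal.subset_span ?_))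
    · exact Or.inr (Or.inr ⟨j, rfl⟩)
    · exact Or.inr (Or.inl rfl)
    · exact Or.inl rfl)
  set B : ℕ → Submodule ℂ (MvPolynomial (Fin (n + 1) ⊕ Fin 2) ℂ) :=
    fun k => weightedHomogeneousSubmodule ℂ (aux_w n) (k, 2 * M) with hB
  set V : ℕ → Submodule ℂ (AuxS F P → ℂ) := fun k => (B k).map (auxEv F P).toLinearMap with hV
  have hWex : ∀ r, ∃ W : Finset (AuxS F P → ℂ), Submodule.span ℂ (W : Set _) = V r :=
    fun r => (aux_fg n (r, 2 * M)).map _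
  choose W hW using hWex
  have hPev : ∀ q, auxEv F P (rename Sum.inl (homogenizeC (toComplex P))) q =
      (eval q.1.1 P : ℝ) := by
    intro q
    rw [auxEv_apply, aux_eval_hom]
  have hxev : ∀ q, auxEv F P (X (Sum.inl i.succ)) q = (q.1.1 i : ℂ) := by
    intro q
    rw [auxEv_apply]
    simp [auxPt]
  refine aux_count V (auxEv F P (kktH0 P c)) (auxEv F P L)
    (auxEv F P (rename Sum.inl (homogenizeC (toComplex P)))) (auxEv F P (X (Sum.inl i.succ)))
    P.totalDegree ((n + 1) * M) hP ((Finset.range ((n + 1) * M)).biUnion W) ?_ ?_ ?_ ?_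
  · intro r hr
    rw [← hW r]
    apply Submodule.span_mono
    intro y hy
    simp only [Finset.coe_biUnion, Set.mem_iUnion]
    exact ⟨r, by simpa using hr, hy⟩
  · intro k hk v hv
    obtain ⟨f, hf, rfl⟩ := hv
    have hf' : IsWeightedHomogeneous (aux_w n) f (k, 2 * M) := hf
    have hfJ := aux_large n M J hM k hk f hf'
    rw [hJdef, Ideal.mem_span_insert] at hfJ
    obtain ⟨a, z, hz, hfa⟩ := hfJ
    rw [Ideal.mem_span_insert] at hz
    obtain ⟨b, t, ht, rfl⟩ := hz
    have hcomp : f = weightedHomogeneousComponent (aux_w n) (k, 2 * M) (a * L) +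
        (weightedHomogeneousComponent (aux_w n) (k, 2 * M) (b * kktH0 P c) +
          weightedHomogeneousComponent (aux_w n) (k, 2 * M) t) := by
      rw [← map_add, ← map_add, ← hfa, hf'.weightedHomogeneousComponent_same]
    have ht' := auxEv_span F P _ (aux_comp_span (aux_w n) (kktH F P) _ (aux_kktH_hom F P)
      (k, 2 * M) t ht)
    have h1 : ∀ (d : ℕ) (b h : MvPolynomial (Fin (n + 1) ⊕ Fin 2) ℂ),
        IsWeightedHomogeneous (aux_w n) h (d, 0) → ∃ w,
        auxEv F P (weightedHomogeneousComponent (aux_w n) (k, 2 * M) (b * h)) =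
          auxEv F P h * w ∧ (w = 0 ∨ ∃ k', k' + d = k ∧ w ∈ V k') := by
      intro d b h hh
      by_cases hdk : d ≤ k
      · refine ⟨auxEv F P (weightedHomogeneousComponent (aux_w n) (k - d, 2 * M) b), ?_,
          Or.inr ⟨k - d, by omega, ?_⟩⟩
        · rw [aux_comp_mul (aux_w n) b h (k, 2 * M) (k - d, 2 * M) (d, 0) hh
            (by simp [hdk]), map_mul, mul_comm]
        · exact Submodule.mem_map_of_mem (weightedHomogeneousComponent_mem _ _ _)
      · refine ⟨0, ?_, Or.inl rfl⟩
        rw [aux_comp_mul_not (aux_w n) b h (k, 2 * M) (d, 0) hh (by simp [hdk])]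
        simp
    obtain ⟨w, hw1, hw2⟩ := h1 _ b _ (aux_kktH0_hom P c)
    obtain ⟨z, hz1, hz2⟩ := h1 _ a _ hLh
    refine ⟨w, z, ?_, hw2, hz2⟩
    rw [hcomp]
    simp only [AlgHom.toLinearMap_apply, map_add]
    rw [ht', hw1, hz1]
    ring
  · intro k a b hab
    have hX : ∀ i, IsWeightedHomogeneous (aux_w n) (X i : MvPolynomial _ ℂ) (aux_w n i) :=
      fun i => isWeightedHomogeneous_X _ _ i
    refine ⟨(rename Sum.inl (homogenizeC (toComplex P))) ^ a * X (Sum.inl i.succ) ^ b *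
      X (Sum.inl 0) ^ (k - P.totalDegree * a - b) * X (Sum.inr 0) ^ (2 * M), ?_, ?_⟩
    · refine aux_cast (((((aux_homogenize_hom (toComplex P)).pow a).mul
        ((hX (Sum.inl i.succ)).pow b)).mul
        ((hX (Sum.inl 0)).pow (k - P.totalDegree * a - b))).mul
        ((hX (Sum.inr 0)).pow (2 * M))) ?_
      rw [aux_toComplex_deg]
      ext
      · simp [aux_w, mul_comm a]
        omega
      · simp [aux_w]
    · funext q
      have e1 : auxEv F P (X (Sum.inl 0)) q = 1 := by rw [auxEv_apply]; simp [auxPt]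
      have e2 : auxEv F P (X (Sum.inr 0)) q = 1 := by rw [auxEv_apply]; simp [auxPt]
      simp [e1, e2]
  · intro m
    refine aux_li_s4 _ _ ((fun ξ : ℝ => (ξ : ℂ)) '' E)
      (hE.image Complex.ofReal_injective.injOn) ?_ m
    rintro _ ⟨ξ, hξ, rfl⟩
    refine ((h ξ hξ).image (f := fun r : ℝ => (r : ℂ)) Complex.ofReal_injective.injOn).mono ?_
    rintro _ ⟨_, ⟨x, ⟨hx, u, hu⟩, rfl⟩, rfl⟩
    refine ⟨⟨(x, u), hu⟩, ?_, ?_⟩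
    · refine (hPev ⟨(x, u), hu⟩).trans ?_
      exact congrArg _ hx
    · exact hxev ⟨(x, u), hu⟩

/-- If for some `c ∈ ℂ` the set of complex projective KKT points of `F` on
`{P = c}` is finite, then for all `ξ ∈ ℝ` outside a finite set `E`, the set of (real) critical
points of `F` on `{P = ξ}` is finite. -/
theorem crit_finite (n : ℕ) (F P : MvPolynomial (Fin n) ℝ) (hP : 0 < P.totalDegree)
    (hfin : ∃ c : ℂ, (projKKT F P c).Finite) :
    ∃ E : Set ℝ, E.Finite ∧ ∀ ξ : ℝ, ξ ∉ E →
      {x : Fin n → ℝ | eval x P = ξ ∧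
        ∃ u : ℝ, ∀ j, eval x (pderiv j F) = u * eval x (pderiv j P)}.Finite := by
  obtain ⟨c, hc⟩ := hfin
  set S : ℝ → Set (Fin n → ℝ) := fun ξ => {x : Fin n → ℝ | eval x P = ξ ∧
        ∃ u : ℝ, ∀ j, eval x (pderiv j F) = u * eval x (pderiv j P)} with hS
  refine ⟨⋃ i : Fin n, {ξ | ((fun x : Fin n → ℝ => x i) '' S ξ).Infinite}, ?_, ?_⟩
  · refine Set.finite_iUnion fun i => ?_
    by_contra hinf
    exact aux_main F P hP c hc i _ hinf (fun ξ hξ => hξ)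
  · intro ξ hξ
    change (S ξ).Finite
    have h : ∀ i : Fin n, ((fun x : Fin n → ℝ => x i) '' S ξ).Finite := by
      intro i
      by_contra hcon
      exact hξ (Set.mem_iUnion.mpr ⟨i, hcon⟩)
    refine (Set.Finite.pi' h).subset ?_
    intro x hx i
    exact ⟨x, hx, rfl⟩
end

section
/- Let F, P_1,…,P_s ∈ ℝ[X_1,…,X_n] and let x̄ ∈ ℝ^n satisfy P_i(x̄) = 0 for all i, with the gradients ∇P_1(x̄),…,∇P_s(x̄) linearly independent. Let ū ∈ ℝ^s satisfy ∇F(x̄) = Σ_{i=1}^s ū_i ∇P_i(x̄), and assume the KKT Jacobian of (F;P_1,…,P_s) at (x̄,ū) is invertible (this is equivalent to x̄ being a non-degenerate critical point of F restricted to the manifold {P_1 = ⋯ = P_s = 0}, as proved in the paper). Then there exist an open neighborhood W of 0 in ℝ^s and C^∞ maps x : W → ℝ^n and u : W → ℝ^s with x(0) = x̄ and u(0) = ū such that for every ξ ∈ W: P_i(x(ξ)) = ξ_i for all i, ∇F(x(ξ)) = Σ_{i=1}^s u_i(ξ) ∇P_i(x(ξ)), and the KKT Jacobian of (F;P_1,…,P_s)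 at (x(ξ),u(ξ)) is invertible. In particular, for every ξ ∈ W the point x(ξ) is a non-degenerate critical point of F on V_ξ, and x(ξ) → x̄ as ξ → 0. (Real-number form of the theorem on persistence of non-degenerate critical points under perturbation of a non-singular algebraic set.) -/
open MvPolynomial

/-- The `(n+k)×(n+k)` KKT Jacobian determinant of `(F;P_1,…,P_k)` at `(x,u)`:
the determinant of the block matrix
`[[Hess F(x) − Σ_i u_i·Hess P_i(x), −J(x)^T],[J(x), 0]]` with `J(x) = [∂P_i/∂X_j(x)]`. -/
noncomputable def kktDet {n : ℕ} {ι : Type} [Fintype ι] [DecidableEq ι]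
    (F : MvPolynomial (Fin n) ℝ) (P : ι → MvPolynomial (Fin n) ℝ)
    (x : Fin n → ℝ) (u : ι → ℝ) : ℝ :=
  (Matrix.fromBlocks
    (Matrix.of fun (i j : Fin n) =>
      eval x (pderiv j (pderiv i F)) - ∑ l, u l * eval x (pderiv j (pderiv i (P l))))
    (Matrix.of fun (i : Fin n) (l : ι) => - eval x (pderiv i (P l)))
    (Matrix.of fun (l : ι) (j : Fin n) => eval x (pderiv j (P l)))
    0).det

theorem mvp_hasStrictFDerivAt {σ : Type} [Fintype σ] (p : MvPolynomial σ ℝ) (y : σ → ℝ) :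
    HasStrictFDerivAt (fun z : σ → ℝ => eval z p)
      (∑ b, eval y (pderiv b p) • (ContinuousLinearMap.proj b : (σ → ℝ) →L[ℝ] ℝ)) y := by
  classical
  induction p using MvPolynomial.induction_on with
  | C a =>
    simpa using (hasStrictFDerivAt_const a y)
  | add p q hp hq =>
    simpa [add_smul, Finset.sum_add_distrib] using hp.fun_add hq
  | mul_X p i hp =>
    have h := hp.fun_mul (ContinuousLinearMap.proj i : (σ → ℝ) →L[ℝ] ℝ).hasStrictFDerivAt
    simp only [eval_mul, eval_X]
    refine h.congr_fderiv ?_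
    ext v
    simp only [ContinuousLinearMap.add_apply, ContinuousLinearMap.smul_apply,
      ContinuousLinearMap.sum_apply, ContinuousLinearMap.proj_apply, Derivation.leibniz, pderiv_X,
      eval_add, smul_eq_mul, eval_mul, eval_X, add_mul, Finset.sum_add_distrib, Finset.mul_sum]
    congr 1
    · rw [Finset.sum_eq_single i]
      · simp
      · intro b _ hb
        simp [Pi.single_apply, hb.symm]
      · simp
    · refine Finset.sum_congr rfl fun b _ => by ring

theorem mvp_map_hasStrictFDerivAt {σ : Type} [Fintype σ] [DecidableEq σ]
    (Q : σ → MvPolynomial σ ℝ) (y : σ → ℝ) :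
    HasStrictFDerivAt (fun (z : σ → ℝ) (a : σ) => eval z (Q a))
      (LinearMap.toContinuousLinearMap
        (Matrix.toLin' (Matrix.of fun a b => eval y (pderiv b (Q a))))) y := by
  rw [hasStrictFDerivAt_pi']
  intro a
  refine (mvp_hasStrictFDerivAt (Q a) y).congr_fderiv ?_
  ext v
  simp [Matrix.mulVec, dotProduct]

theorem mvp_map_hasStrictFDerivAt_equiv {σ : Type} [Fintype σ] [DecidableEq σ]
    (Q : σ → MvPolynomial σ ℝ) (y : σ → ℝ)
    (h : (Matrix.of fun a b => eval y (pderiv b (Q a))).det ≠ 0) :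
    ∃ e : (σ → ℝ) ≃L[ℝ] (σ → ℝ),
      HasStrictFDerivAt (fun (z : σ → ℝ) (a : σ) => eval z (Q a)) (e : (σ → ℝ) →L[ℝ] (σ → ℝ)) y := by
  refine ⟨ContinuousLinearMap.toContinuousLinearEquivOfDetNeZero
    (LinearMap.toContinuousLinearMap
        (Matrix.toLin' (Matrix.of fun a b => eval y (pderiv b (Q a))))) ?_, ?_⟩
  · simpa [ContinuousLinearMap.det, LinearMap.det_toLin'] using h
  · rw [ContinuousLinearMap.coe_toContinuousLinearEquivOfDetNeZero]
    exact mvp_map_hasStrictFDerivAt Q y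

theorem mvp_map_contDiff {σ : Type} [Fintype σ]
    (Q : σ → MvPolynomial σ ℝ) (m : WithTop ℕ∞) :
    ContDiff ℝ m (fun (z : σ → ℝ) (a : σ) => eval z (Q a)) := by
  rw [contDiff_pi]
  intro a
  exact contDiffOn_univ.1 (AnalyticOnNhd.eval_mvPolynomial (Q a)).contDiffOn_of_completeSpace

/-- The KKT map as a polynomial map. -/
noncomputable def kktPoly {n s : ℕ} (F : MvPolynomial (Fin n) ℝ)
    (P : Fin s → MvPolynomial (Fin n) ℝ) : Fin n ⊕ Fin s → MvPolynomial (Fin n ⊕ Fin s) ℝ :=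
  Sum.elim
    (fun j => rename Sum.inl (pderiv j F) - ∑ l, X (Sum.inr l) * rename Sum.inl (pderiv j (P l)))
    (fun i => rename Sum.inl (P i))

theorem pderiv_inr_rename {n s : ℕ} (p : MvPolynomial (Fin n) ℝ) (l : Fin s) :
    pderiv (Sum.inr l : Fin n ⊕ Fin s) (rename Sum.inl p) = 0 := by
  classical
  apply pderiv_eq_zero_of_notMem_vars
  intro h
  have := vars_rename Sum.inl p h
  simp at this

theorem kktPoly_det {n s : ℕ} (F : MvPolynomial (Fin n) ℝ)
    (P : Fin s → MvPolynomial (Fin n) ℝ) (y : Fin n ⊕ Fin s → ℝ) :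
    (Matrix.of fun a b => eval y (pderiv b (kktPoly F P a))).det =
      kktDet F P (y ∘ Sum.inl) (y ∘ Sum.inr) := by
  unfold kktDet
  congr 1
  ext a b
  rcases a with a | a <;> rcases b with b | b
  · simp [kktPoly, pderiv_rename Sum.inl_injective, eval_rename, pderiv_X]
  · simp [kktPoly, pderiv_inr_rename, eval_rename, pderiv_X, Pi.single_apply, apply_ite]
  · simp [kktPoly, pderiv_rename Sum.inl_injective, eval_rename]
  · simp [kktPoly, pderiv_inr_rename]

/-- A non-degenerate critical point of `F` on the non-singular level set
`{P_1 = ⋯ = P_s = 0}` persists: there are `C^∞` families `x(ξ), u(ξ)` of KKT pairs on `V_ξ`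
for all small `ξ`, with invertible KKT Jacobian, and `x(0) = x̄`, `u(0) = ū`. -/
theorem nondegenerate_crit_persists (n s : ℕ) (F : MvPolynomial (Fin n) ℝ)
    (P : Fin s → MvPolynomial (Fin n) ℝ) (xb : Fin n → ℝ) (ub : Fin s → ℝ)
    (hz : ∀ i, eval xb (P i) = 0)
    (hli : LinearIndependent ℝ
      (fun i : Fin s => (fun j => eval xb (pderiv j (P i)) : Fin n → ℝ)))
    (hkkt : ∀ j, eval xb (pderiv j F) = ∑ i, ub i * eval xb (pderiv j (P i)))
    (hnd : kktDet F P xb ub ≠ 0) :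
    ∃ W : Set (Fin s → ℝ), IsOpen W ∧ 0 ∈ W ∧
      ∃ (x : (Fin s → ℝ) → Fin n → ℝ) (u : (Fin s → ℝ) → Fin s → ℝ),
        ContDiffOn ℝ (⊤ : ℕ∞) x W ∧ ContDiffOn ℝ (⊤ : ℕ∞) u W ∧
        x 0 = xb ∧ u 0 = ub ∧
        ∀ ξ ∈ W, (∀ i, eval (x ξ) (P i) = ξ i) ∧
          (∀ j, eval (x ξ) (pderiv j F) = ∑ i, u ξ i * eval (x ξ) (pderiv j (P i))) ∧
          kktDet F P (x ξ) (u ξ) ≠ 0 := by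
  classical
  set Q := kktPoly F P with hQ
  set G : (Fin n ⊕ Fin s → ℝ) → (Fin n ⊕ Fin s → ℝ) := fun z a => eval z (Q a) with hG
  set yb : Fin n ⊕ Fin s → ℝ := Sum.elim xb ub with hyb
  have key : ∀ y, kktDet F P (y ∘ Sum.inl) (y ∘ Sum.inr) ≠ 0 →
      ∃ e : (Fin n ⊕ Fin s → ℝ) ≃L[ℝ] (Fin n ⊕ Fin s → ℝ),
        HasStrictFDerivAt G (e : (Fin n ⊕ Fin s → ℝ) →L[ℝ] (Fin n ⊕ Fin s → ℝ)) y := by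
    intro y hy
    exact mvp_map_hasStrictFDerivAt_equiv Q y (by rw [hQ, kktPoly_det]; exact hy)
  obtain ⟨e0, he0⟩ := key yb (by simpa [hyb] using hnd)
  set E := he0.toOpenPartialHomeomorph G with hE
  have hEc : (E : _ → _) = G := rfl
  let inj : (Fin s → ℝ) → (Fin n ⊕ Fin s → ℝ) := fun ξ => Sum.elim (fun _ => 0) ξ
  have hinj : ContDiff ℝ (⊤ : ℕ∞) inj := by
    rw [contDiff_pi]
    rintro (j | i)
    · exact contDiff_const
    · exact contDiff_apply ℝ ℝ i
  have hGb : G yb = inj 0 := by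
    funext a
    rcases a with j | i
    · simp [hG, hQ, hyb, kktPoly, inj, eval_rename, hkkt]
    · simp [hG, hQ, hyb, kktPoly, inj, eval_rename, hz]
  have hdc : Continuous fun y : Fin n ⊕ Fin s → ℝ => kktDet F P (y ∘ Sum.inl) (y ∘ Sum.inr) := by
    simp_rw [← kktPoly_det]
    refine Continuous.matrix_det ?_
    refine continuous_matrix fun a b => ?_
    exact MvPolynomial.continuous_eval _
  have hsy : E.symm (inj 0) = yb := by
    rw [← hGb]
    exact E.left_inv he0.mem_toOpenPartialHomeomorph_source
  let U : Set (Fin n ⊕ Fin s → ℝ) := {y | kktDet F P (y ∘ Sum.inl) (y ∘ Sum.inr) ≠ 0}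
  have hU : IsOpen U := isOpen_ne.preimage hdc
  have hW : IsOpen (E.target ∩ E.symm ⁻¹' U) := E.isOpen_inter_preimage_symm hU
  have hsm : ContDiffOn ℝ (⊤ : ℕ∞) (fun ξ => E.symm (inj ξ)) (inj ⁻¹' (E.target ∩ E.symm ⁻¹' U)) := by
    intro ξ hξ
    obtain ⟨e, he⟩ := key _ hξ.2
    have h1 : ContDiffAt ℝ (⊤ : ℕ∞) E.symm (inj ξ) :=
      E.contDiffAt_symm hξ.1 he.hasFDerivAt (mvp_map_contDiff Q _).contDiffAt
    exact (h1.comp ξ hinj.contDiffAt).contDiffWithinAt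
  refine ⟨inj ⁻¹' (E.target ∩ E.symm ⁻¹' U), hW.preimage hinj.continuous, ⟨?_, ?_⟩,
    fun ξ => E.symm (inj ξ) ∘ Sum.inl, fun ξ => E.symm (inj ξ) ∘ Sum.inr, ?_, ?_, ?_, ?_, ?_⟩
  · rw [← hGb]
    exact he0.image_mem_toOpenPartialHomeomorph_target
  · change kktDet F P (E.symm (inj 0) ∘ Sum.inl) (E.symm (inj 0) ∘ Sum.inr) ≠ 0
    rw [hsy]
    simpa [hyb] using hnd
  · exact contDiffOn_pi.2 fun j => contDiffOn_pi.1 hsm (Sum.inl j)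
  · exact contDiffOn_pi.2 fun j => contDiffOn_pi.1 hsm (Sum.inr j)
  · simp [hsy, hyb]
  · simp [hsy, hyb]
  · intro ξ hξ
    have hr : G (E.symm (inj ξ)) = inj ξ := E.right_inv hξ.1
    refine ⟨fun i => ?_, fun j => ?_, hξ.2⟩
    · have := congrFun hr (Sum.inr i)
      simpa [hG, hQ, kktPoly, inj, eval_rename] using this
    · have := congrFun hr (Sum.inl j)
      simpa [hG, hQ, kktPoly, inj, eval_rename, sub_eq_zero] using this
end

section
/- Let F, P_1,…,P_s ∈ ℝ[X_1,…,X_n] with {P_1,…,P_s} in general position. Let ξ_k be a sequence of positive reals with ξ_k → 0, and let x_k ∈ ℝ^n be a sequence such that for every k: ∏_{i=1}^s P_i(x_k) = ξ_k and there exists λ_k ∈ ℝ with ∇F(x_k) = λ_k·∇(∏_{i=1}^s P_i)(x_k). Assume x_k → x̄ ∈ ℝ^n. Then, with I = {i ∈ {1,…,s} : P_i(x̄) = 0} (which is nonempty), the gradient ∇F(x̄) lies in the linear span of {∇P_i(x̄) : i ∈ I}; i.e., x̄ is a critical point of F on the stratum of {∏ P_i = 0} containing x̄ with respect to its canonical Whitney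 stratification. (Real-number form of the theorem that the limit of bounded critical points of F on V_ξ is a critical point of F on V.) -/
open MvPolynomial

/-- `{P_1,…,P_s}` is in general position: at every common real zero of a subfamily, the
gradients of that subfamily are linearly independent. -/
def GeneralPosition {n s : ℕ} (P : Fin s → MvPolynomial (Fin n) ℝ) : Prop :=
  ∀ (I : Finset (Fin s)) (x : Fin n → ℝ), (∀ i ∈ I, eval x (P i) = 0) →
    LinearIndependent ℝ
      (fun i : {i // i ∈ I} => (fun j => eval x (pderiv j (P i.1)) : Fin n → ℝ))

theorem eval_pderiv_prod {n s : ℕ} (P : Fin s → MvPolynomial (Fin n) ℝ) (x : Fin n → ℝ)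
    (j : Fin n) (S : Finset (Fin s)) (h : ∀ i ∈ S, eval x (P i) ≠ 0) :
    eval x (pderiv j (∏ i ∈ S, P i)) =
      (eval x (∏ i ∈ S, P i)) * ∑ i ∈ S, eval x (pderiv j (P i)) / eval x (P i) := by
  classical
  induction S using Finset.induction_on with
  | empty => simp
  | insert a S ha ih =>
    have ih' := ih (fun i hi => h i (Finset.mem_insert_of_mem hi))
    have h0 := h a (Finset.mem_insert_self a S)
    rw [Finset.prod_insert ha, Finset.sum_insert ha, Derivation.leibniz]
    simp only [smul_eq_mul, map_add, map_mul, ih']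
    field_simp
    ring

set_option maxHeartbeats 2000000 in
open Filter Topology in
theorem key_limit {ι : Type} [Fintype ι] [DecidableEq ι] [Nonempty ι] {n : ℕ}
    (A : ℕ → Matrix ι (Fin n) ℝ) (A0 : Matrix ι (Fin n) ℝ) (hA : Tendsto A atTop (𝓝 A0))
    (li : LinearIndependent ℝ A0.row) (f r : ℕ → Fin n → ℝ) (f0 r0 : Fin n → ℝ)
    (hf : Tendsto f atTop (𝓝 f0)) (hr : Tendsto r atTop (𝓝 r0))
    (p : ℕ → ι → ℝ) (hp : Tendsto p atTop (𝓝 0)) (hp0 : ∀ k i, p k i ≠ 0) (c : ℕ → ℝ)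
    (h : ∀ k, f k = Matrix.vecMul (fun i => c k / p k i) (A k) + c k • r k) :
    ∃ m : ι → ℝ, f0 = Matrix.vecMul m A0 := by
  have hdet0 : (A0 * A0.transpose).det ≠ 0 := by
    rw [← isUnit_iff_ne_zero, ← Matrix.isUnit_iff_isUnit_det,
      ← Matrix.linearIndependent_rows_iff_isUnit, linearIndependent_iff_card_eq_finrank_span,
      Set.finrank, ← Matrix.rank_eq_finrank_span_row, Matrix.rank_self_mul_transpose]
    exact li.rank_matrix.symm
  have hG : Tendsto (fun k => A k * (A k).transpose) atTop (𝓝 (A0 * A0.transpose)) :=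
    ((continuous_id.matrix_mul continuous_id.matrix_transpose).tendsto A0).comp hA
  have hinv : Tendsto (fun k => (A k * (A k).transpose)⁻¹) atTop
      (𝓝 (A0 * A0.transpose)⁻¹) := by
    refine Tendsto.comp (continuousAt_matrix_inv _ ?_) hG
    rw [Ring.inverse_eq_inv']
    exact continuousAt_inv₀ hdet0
  let L : ℕ → Matrix (Fin n) ι ℝ := fun k => (A k).transpose * (A k * (A k).transpose)⁻¹
  let L0 : Matrix (Fin n) ι ℝ := A0.transpose * (A0 * A0.transpose)⁻¹
  have hmulc : Continuous (fun q : Matrix ι (Fin n) ℝ × Matrix ι ι ℝ => q.1.transpose * q.2) :=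
    continuous_fst.matrix_transpose.matrix_mul continuous_snd
  have hL : Tendsto L atTop (𝓝 L0) := (hmulc.tendsto (A0, _)).comp (hA.prodMk_nhds hinv)
  have hvm : Continuous (fun q : (Fin n → ℝ) × Matrix (Fin n) ι ℝ => Matrix.vecMul q.1 q.2) :=
    continuous_fst.matrix_vecMul continuous_snd
  have hvm2 : Continuous (fun q : (ι → ℝ) × Matrix ι (Fin n) ℝ => Matrix.vecMul q.1 q.2) :=
    continuous_fst.matrix_vecMul continuous_snd
  have hfL := (hvm.tendsto (f0, L0)).comp (hf.prodMk_nhds hL)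
  have hrL := (hvm.tendsto (r0, L0)).comp (hr.prodMk_nhds hL)
  have hev : ∀ᶠ k in atTop, (A k * (A k).transpose).det ≠ 0 :=
    (((continuous_id.matrix_det).tendsto _).comp hG).eventually_ne hdet0
  have hmu : ∀ᶠ k in atTop, (fun i => c k / p k i) =
      Matrix.vecMul (f k) (L k) - c k • Matrix.vecMul (r k) (L k) := by
    filter_upwards [hev] with k hk
    have hAL : A k * L k = 1 := by
      simp only [L]
      rw [← Matrix.mul_assoc, Matrix.mul_nonsing_inv _ (isUnit_iff_ne_zero.2 hk)]
    rw [h k, Matrix.add_vecMul, Matrix.vecMul_vecMul, hAL, Matrix.vecMul_one,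
      Matrix.smul_vecMul, add_sub_cancel_right]
  have hc : Tendsto c atTop (𝓝 0) := by
    obtain ⟨i⟩ := ‹Nonempty ι›
    have hpi : Tendsto (fun k => p k i) atTop (𝓝 0) := (tendsto_pi_nhds.1 hp) i
    have hfi : Tendsto (fun k => Matrix.vecMul (f k) (L k) i) atTop (𝓝 (Matrix.vecMul f0 L0 i)) :=
      (tendsto_pi_nhds.1 hfL) i
    have hri : Tendsto (fun k => Matrix.vecMul (r k) (L k) i) atTop (𝓝 (Matrix.vecMul r0 L0 i)) :=
      (tendsto_pi_nhds.1 hrL) i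
    have hden : Tendsto (fun k => 1 + p k i * Matrix.vecMul (r k) (L k) i) atTop (𝓝 1) := by
      simpa using (hpi.mul hri).const_add 1
    have hq := (hpi.mul hfi).div hden one_ne_zero
    rw [zero_mul, zero_div] at hq
    refine hq.congr' ?_
    filter_upwards [hmu, hden.eventually_ne one_ne_zero] with k hk hk1
    have e := congrFun hk i
    simp only [Pi.sub_apply, Pi.smul_apply, smul_eq_mul] at e
    have := hp0 k i
    simp only [Pi.div_apply, Pi.mul_apply]
    rw [div_eq_iff hk1]
    rw [div_eq_iff this] at e
    linarith
  have hmulim : Tendsto (fun k => (fun i => c k / p k i)) atTop (𝓝 (Matrix.vecMul f0 L0)) := by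
    have := hfL.sub (hc.smul hrL)
    simp only [zero_smul, sub_zero] at this
    refine this.congr' ?_
    filter_upwards [hmu] with k hk
    exact hk.symm
  refine ⟨Matrix.vecMul f0 L0, ?_⟩
  have h1 := ((hvm2.tendsto (_, A0)).comp (hmulim.prodMk_nhds hA)).add (hc.smul hr)
  simp only [zero_smul, add_zero] at h1
  refine tendsto_nhds_unique hf (h1.congr fun k => ?_)
  exact (h k).symm

/-- If `{P_1,…,P_s}` is in general position and `x_k` are critical points of
`F` on `{∏ P_i = ξ_k}` with `ξ_k → 0⁺` and `x_k → x̄`, then `I = {i : P_i(x̄) = 0}` is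
nonempty and `∇F(x̄)` lies in the span of `{∇P_i(x̄) : i ∈ I}`, i.e. `x̄` is a critical point
of `F` on the stratum of `{∏ P_i = 0}` containing it. -/
theorem limit_of_crit_points (n s : ℕ) (F : MvPolynomial (Fin n) ℝ)
    (P : Fin s → MvPolynomial (Fin n) ℝ) (hgp : GeneralPosition P)
    (ξ : ℕ → ℝ) (hξpos : ∀ k, 0 < ξ k) (hξ0 : Filter.Tendsto ξ Filter.atTop (nhds 0))
    (x : ℕ → Fin n → ℝ)
    (hmem : ∀ k, eval (x k) (∏ i, P i) = ξ k)
    (hcrit : ∀ k, ∃ lam : ℝ,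
      ∀ j, eval (x k) (pderiv j F) = lam * eval (x k) (pderiv j (∏ i, P i)))
    (xb : Fin n → ℝ) (hconv : Filter.Tendsto x Filter.atTop (nhds xb)) :
    (∃ i, eval xb (P i) = 0) ∧
    (fun j => eval xb (pderiv j F)) ∈ Submodule.span ℝ
      {v : Fin n → ℝ | ∃ i, eval xb (P i) = 0 ∧ v = fun j => eval xb (pderiv j (P i))} := by
  classical
  have hcont : ∀ Q : MvPolynomial (Fin n) ℝ,
      Filter.Tendsto (fun k => eval (x k) Q) Filter.atTop (nhds (eval xb Q)) := fun Q =>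
    ((MvPolynomial.continuous_eval Q).tendsto xb).comp hconv
  have hex : ∃ i, eval xb (P i) = 0 := by
    have h1 : eval xb (∏ i, P i) = 0 :=
      tendsto_nhds_unique (hcont _) (hξ0.congr fun k => (hmem k).symm)
    rw [map_prod, Finset.prod_eq_zero_iff] at h1
    obtain ⟨i, -, hi⟩ := h1
    exact ⟨i, hi⟩
  refine ⟨hex, ?_⟩
  have hne : ∀ k i, eval (x k) (P i) ≠ 0 := by
    intro k i hi
    have h1 := hmem k
    rw [map_prod, Finset.prod_eq_zero (Finset.mem_univ i) hi] at h1
    exact (hξpos k).ne h1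
  choose lam hlam using hcrit
  let I : Finset (Fin s) := Finset.univ.filter fun i => eval xb (P i) = 0
  have hI : ∀ i, i ∈ I ↔ eval xb (P i) = 0 := fun i => by simp [I]
  haveI : Nonempty {i // i ∈ I} := by
    obtain ⟨i, hi⟩ := hex
    exact ⟨⟨i, (hI i).2 hi⟩⟩
  obtain ⟨m, hm⟩ := key_limit (ι := {i // i ∈ I})
    (fun k => Matrix.of fun i j => eval (x k) (pderiv j (P i.1)))
    (Matrix.of fun i j => eval xb (pderiv j (P i.1)))
    (by
      refine tendsto_pi_nhds.2 fun i => tendsto_pi_nhds.2 fun j => ?_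
      exact hcont _)
    (hgp I xb fun i hi => (hI i).1 hi)
    (fun k j => eval (x k) (pderiv j F))
    (fun k j => ∑ i ∈ Iᶜ, eval (x k) (pderiv j (P i)) / eval (x k) (P i))
    (fun j => eval xb (pderiv j F))
    (fun j => ∑ i ∈ Iᶜ, eval xb (pderiv j (P i)) / eval xb (P i))
    (tendsto_pi_nhds.2 fun j => hcont _)
    (tendsto_pi_nhds.2 fun j => tendsto_finsetSum _ fun i hi =>
      (hcont _).div (hcont _) (by
        rw [Finset.mem_compl, hI] at hi
        exact hi))
    (fun k i => eval (x k) (P i.1))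
    (tendsto_pi_nhds.2 fun i => by
      have h1 := hcont (P i.1)
      rw [(hI i.1).1 i.2] at h1
      exact h1)
    (fun k i => hne k i.1)
    (fun k => lam k * ξ k)
    (by
      intro k
      funext j
      rw [hlam k j, eval_pderiv_prod P (x k) j Finset.univ (fun i _ => hne k i), hmem k,
        ← Finset.sum_add_sum_compl I]
      simp only [Pi.add_apply, Pi.smul_apply, smul_eq_mul, Matrix.vecMul, dotProduct,
        Matrix.of_apply]
      rw [← Finset.sum_coe_sort I, mul_add, mul_add, Finset.mul_sum, Finset.mul_sum, mul_assoc]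
      congr 1
      refine Finset.sum_congr rfl fun i _ => ?_
      ring)
  rw [hm, Matrix.vecMul_eq_sum]
  refine Submodule.sum_mem _ fun i _ => Submodule.smul_mem _ _ (Submodule.subset_span ?_)
  exact ⟨i.1, (hI i.1).1 i.2, rfl⟩
end

section
/- Let P_1,…,P_s ∈ ℝ[X_1,…,X_n] and suppose V = {x : P_i(x) = 0 ∀i} is nonempty and non-singular (every point of V is a non-singular zero of {P_1,…,P_s}). Let ξ_k ∈ ℝ^s with ξ_k → 0, and let x_k ∈ ℝ^n satisfy P_i(x_k) = (ξ_k)_i for all i, with x_k → x̄ (so x̄ ∈ V). Then: (a) whenever h_k → h in ℝ^n with ⟨∇P_i(x_k), h_k⟩ = 0 for all i and all k, one has ⟨∇P_i(x̄), h⟩ = 0 for all i; and (b) for every h ∈ ℝ^n with ⟨∇P_i(x̄), h⟩ = 0 for all i, there exists a sequence h_k → h with ⟨∇P_i(x_k), h_k⟩ = 0 for all i and all k. (Real-number form of the proposition that lim_ξ(T_{x_ξ} V_ξ) = T_{x̄} V for a non-singular algebraic set.) -/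
open MvPolynomial

/-- For a nonempty non-singular `V = {P_i = 0 ∀i}` and points
`x_k ∈ V_{ξ_k}` with `ξ_k → 0` and `x_k → x̄`, the tangent spaces of `V_{ξ_k}` at `x_k`
converge to the tangent space of `V` at `x̄`: (a) limits of tangent vectors are tangent, and
(b) every tangent vector at `x̄` is a limit of tangent vectors. -/
theorem tangent_spaces_converge (n s : ℕ) (P : Fin s → MvPolynomial (Fin n) ℝ)
    (hne : ∃ x : Fin n → ℝ, ∀ i, eval x (P i) = 0)
    (hns : ∀ x : Fin n → ℝ, (∀ i, eval x (P i) = 0) →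
      (Matrix.of fun (i : Fin s) (j : Fin n) => eval x (pderiv j (P i))).rank = s)
    (ξ : ℕ → Fin s → ℝ) (hξ : Filter.Tendsto ξ Filter.atTop (nhds 0))
    (x : ℕ → Fin n → ℝ) (hxk : ∀ k i, eval (x k) (P i) = ξ k i)
    (xb : Fin n → ℝ) (hx : Filter.Tendsto x Filter.atTop (nhds xb)) :
    (∀ (h : ℕ → Fin n → ℝ) (h0 : Fin n → ℝ),
      Filter.Tendsto h Filter.atTop (nhds h0) →
      (∀ k i, ∑ j, eval (x k) (pderiv j (P i)) * h k j = 0) →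
      ∀ i, ∑ j, eval xb (pderiv j (P i)) * h0 j = 0) ∧
    (∀ h0 : Fin n → ℝ, (∀ i, ∑ j, eval xb (pderiv j (P i)) * h0 j = 0) →
      ∃ h : ℕ → Fin n → ℝ, Filter.Tendsto h Filter.atTop (nhds h0) ∧
        ∀ k i, ∑ j, eval (x k) (pderiv j (P i)) * h k j = 0) := by
  classical
  let J : (Fin n → ℝ) → Matrix (Fin s) (Fin n) ℝ :=
    fun y => Matrix.of fun i j => eval y (pderiv j (P i))
  have hJe : ∀ y i j, J y i j = eval y (pderiv j (P i)) := fun y i j => rfl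
  have hent : ∀ i j, Filter.Tendsto (fun k => eval (x k) (pderiv j (P i))) Filter.atTop
      (nhds (eval xb (pderiv j (P i)))) := fun i j =>
    ((MvPolynomial.continuous_eval (pderiv j (P i))).tendsto xb).comp hx
  have hV : ∀ i, eval xb (P i) = 0 := by
    intro i
    have h1 : Filter.Tendsto (fun k => eval (x k) (P i)) Filter.atTop (nhds (eval xb (P i))) :=
      ((MvPolynomial.continuous_eval (P i)).tendsto xb).comp hx
    have h2 : Filter.Tendsto (fun k => ξ k i) Filter.atTop (nhds 0) :=
      (tendsto_pi_nhds.1 hξ) i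
    simp only [hxk] at h1
    exact tendsto_nhds_unique h1 h2
  have hJ : Filter.Tendsto (fun k => J (x k)) Filter.atTop (nhds (J xb)) :=
    tendsto_pi_nhds.2 fun i => tendsto_pi_nhds.2 fun j => hent i j
  constructor
  · intro h h0 hh hk i
    have h1 : Filter.Tendsto (fun k => ∑ j, eval (x k) (pderiv j (P i)) * h k j) Filter.atTop
        (nhds (∑ j, eval xb (pderiv j (P i)) * h0 j)) :=
      tendsto_finsetSum _ fun j _ => (hent i j).mul ((tendsto_pi_nhds.1 hh) j)
    simp only [hk] at h1
    exact tendsto_nhds_unique h1 tendsto_const_nhds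
  · intro h0 hh0
    have hsurj : Function.Surjective (J xb).mulVec := by
      have hr : (J xb).rank = s := hns xb hV
      have : LinearMap.range (J xb).mulVecLin = ⊤ := by
        apply Submodule.eq_top_of_finrank_eq
        rw [Module.finrank_fin_fun]
        exact hr
      exact LinearMap.range_eq_top.1 this
    obtain ⟨R, hR⟩ := Matrix.mulVec_surjective_iff_exists_right_inverse.1 hsurj
    have hJ0 : (J xb).mulVec h0 = 0 := funext fun i => hh0 i
    have hM : Filter.Tendsto (fun k => J (x k) * R) Filter.atTop (nhds 1) := by
      rw [← hR]
      exact ((continuous_id.matrix_mul continuous_const).tendsto (J xb)).comp hJ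
    have hdet : Filter.Tendsto (fun k => (J (x k) * R).det) Filter.atTop (nhds 1) := by
      have := ((continuous_id.matrix_det).tendsto (1 : Matrix (Fin s) (Fin s) ℝ)).comp hM
      simpa [Function.comp_def] using this
    have hadj : Filter.Tendsto (fun k => (J (x k) * R).adjugate) Filter.atTop (nhds 1) := by
      have := ((continuous_id.matrix_adjugate).tendsto (1 : Matrix (Fin s) (Fin s) ℝ)).comp hM
      simpa [Function.comp_def] using this
    have hv : Filter.Tendsto (fun k => (J (x k)).mulVec h0) Filter.atTop (nhds 0) := by
      rw [← hJ0]
      exact ((continuous_id.matrix_mulVec continuous_const).tendsto (J xb)).comp hJ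
    have hw : Filter.Tendsto (fun k => ((J (x k) * R).adjugate).mulVec ((J (x k)).mulVec h0))
        Filter.atTop (nhds 0) := by
      have := ((continuous_fst.matrix_mulVec continuous_snd).tendsto
        ((1 : Matrix (Fin s) (Fin s) ℝ), (0 : Fin s → ℝ))).comp (hadj.prodMk_nhds hv)
      simpa [Function.comp_def] using this
    have hu : Filter.Tendsto (fun k => R.mulVec
        (((J (x k) * R).adjugate).mulVec ((J (x k)).mulVec h0))) Filter.atTop (nhds 0) := by
      have := (((continuous_const (y := R)).matrix_mulVec continuous_id).tendsto
        (0 : Fin s → ℝ)).comp hw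
      simpa [Function.comp_def] using this
    have hlim : Filter.Tendsto (fun k => h0 - ((J (x k) * R).det)⁻¹ • R.mulVec
        (((J (x k) * R).adjugate).mulVec ((J (x k)).mulVec h0))) Filter.atTop (nhds h0) := by
      have := (tendsto_const_nhds (x := h0)).sub ((hdet.inv₀ one_ne_zero).smul hu)
      simpa using this
    refine ⟨fun k => if (J (x k) * R).det = 0 then 0 else
      h0 - ((J (x k) * R).det)⁻¹ • R.mulVec
        (((J (x k) * R).adjugate).mulVec ((J (x k)).mulVec h0)), ?_, ?_⟩
    · refine hlim.congr' ?_
      filter_upwards [hdet.eventually_ne one_ne_zero] with k hk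
      rw [if_neg hk]
    · intro k i
      by_cases hk : (J (x k) * R).det = 0
      · simp [hk]
      · simp only [if_neg hk]
        have key : (J (x k)).mulVec (h0 - ((J (x k) * R).det)⁻¹ • R.mulVec
            (((J (x k) * R).adjugate).mulVec ((J (x k)).mulVec h0))) = 0 := by
          rw [Matrix.mulVec_sub, Matrix.mulVec_smul, Matrix.mulVec_mulVec, Matrix.mulVec_mulVec,
            Matrix.mul_adjugate, Matrix.smul_mulVec, Matrix.one_mulVec, smul_smul,
            inv_mul_cancel₀ hk, one_smul, sub_self]
        exact congrFun key i
end

section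
/- Let f, g_1,…,g_r ∈ ℝ[X_1,…,X_n] and let x̄ ∈ ℝ^n be such that, with I = {i : g_i(x̄) = 0} nonempty, one has g_i(x̄) > 0 for every i ∉ I, the gradients {∇g_i(x̄) : i ∈ I} are linearly independent, and there exists ū ∈ ℝ^I with ū_i > 0 for all i ∈ I and ∇f(x̄) = Σ_{i∈I} ū_i ∇g_i(x̄); assume moreover that the KKT Jacobian of (f; {g_i}_{i∈I}) at (x̄, ū) is invertible. Then there exist μ_0 > 0 and a map x : (0,μ_0) → ℝ^n, real-analytic on (0,μ_0), such that for every μ ∈ (0,μ_0): g_i(x(μ)) > 0 for all i = 1,…,r, the log-barrier first-order conditions ∇f(x(μ)) = μ·Σ_{i=1}^r ∇g_i(x(μ))/g_i(x(μ)) hold, and x(μ) is an isolated point of the set {y ∈ ℝ^n : g_i(y) > 0 ∀i and ∇f(y) = μ·Σ_{i=1}^r ∇g_i(y)/g_i(y)}; moreover x extends analytically to μ = 0: there exist ε ∈ (0,μ_0] and a map y : (−ε,ε) → ℝ^n, real-analytic at 0, with y(μ) = x(μ) for μ ∈ (0,ε) and y(0) = x̄. In particular the critical path x(μ) converges to x̄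 and is analytic at μ = 0. (Real-number form of the theorem giving sufficient conditions for the existence, convergence, and smoothness at μ = 0 of a critical path of polynomial optimization.) -/
open MvPolynomial

/-- The map of the inverse function argument. -/
noncomputable def cpPhi {n r : ℕ} (f : MvPolynomial (Fin n) ℝ)
    (g : Fin r → MvPolynomial (Fin n) ℝ) (I : Finset (Fin r))
    (p : ℝ × (Fin n → ℝ) × ({i // i ∈ I} → ℝ)) : ℝ × (Fin n → ℝ) × ({i // i ∈ I} → ℝ) :=
  (p.1,
   fun j => eval p.2.1 (pderiv j f) - ∑ i : {i // i ∈ I}, p.2.2 i * eval p.2.1 (pderiv j (g i.1))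
      - p.1 * ∑ i ∈ Iᶜ, eval p.2.1 (pderiv j (g i)) / eval p.2.1 (g i),
   fun i => p.2.2 i * eval p.2.1 (g i.1) - p.1)

theorem cp_hasDerivAt_eval {n : ℕ} (p : MvPolynomial (Fin n) ℝ) (x d : Fin n → ℝ) :
    HasDerivAt (fun t : ℝ => eval (x + t • d) p) (∑ k, d k * eval x (pderiv k p)) 0 := by
  induction p using MvPolynomial.induction_on with
  | C a => simpa using hasDerivAt_const (0 : ℝ) a
  | add p q hp hq =>
    have := hp.add hq
    simp only [map_add, mul_add, Finset.sum_add_distrib]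
    exact this
  | mul_X p i hp =>
    have h1 : HasDerivAt (fun t : ℝ => x i + t * d i) (d i) 0 := by
      simpa using ((hasDerivAt_id (0 : ℝ)).mul_const (d i)).const_add (x i)
    have := hp.mul h1
    simp only [map_mul, eval_X, Pi.add_apply, Pi.smul_apply, smul_eq_mul]
    refine this.congr_deriv ?_
    simp only [Derivation.leibniz, pderiv_X, smul_eq_mul, map_add, map_mul, eval_X, mul_add,
      Finset.sum_add_distrib, zero_smul, add_zero, zero_mul, Finset.sum_mul]
    rw [add_comm]
    congr 1
    · rw [Finset.sum_eq_single i]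
      · simp; ring
      · intro b _ hb
        simp [hb.symm]
      · simp
    · exact Finset.sum_congr rfl fun k _ => by ring

theorem cp_analyticAt {n r : ℕ} (f : MvPolynomial (Fin n) ℝ)
    (g : Fin r → MvPolynomial (Fin n) ℝ) (I : Finset (Fin r))
    (p : ℝ × (Fin n → ℝ) × ({i // i ∈ I} → ℝ))
    (hp : ∀ i ∉ I, eval p.2.1 (g i) ≠ 0) : AnalyticAt ℝ (cpPhi f g I) p := by
  have h2 : AnalyticAt ℝ (fun p : ℝ × (Fin n → ℝ) × ({i // i ∈ I} → ℝ) => p.2.1) p :=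
    analyticAt_fst.comp analyticAt_snd
  have h3 : AnalyticAt ℝ (fun p : ℝ × (Fin n → ℝ) × ({i // i ∈ I} → ℝ) => p.2.2) p :=
    analyticAt_snd.comp analyticAt_snd
  have h3' : ∀ i, AnalyticAt ℝ (fun p : ℝ × (Fin n → ℝ) × ({i // i ∈ I} → ℝ) => p.2.2 i) p :=
    analyticAt_pi_iff.1 h3
  have he : ∀ q : MvPolynomial (Fin n) ℝ, AnalyticAt ℝ
      (fun p : ℝ × (Fin n → ℝ) × ({i // i ∈ I} → ℝ) => eval p.2.1 q) p := fun q =>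
    (AnalyticOnNhd.eval_mvPolynomial q _ (Set.mem_univ _)).comp
      (g := fun x => eval x q) h2
  refine analyticAt_fst.prod (AnalyticAt.prod ?_ ?_)
  · refine AnalyticAt.pi fun j => ((he _).sub ?_).sub (analyticAt_fst.mul ?_)
    · exact Finset.analyticAt_fun_sum _ fun i _ => (h3' i).mul (he _)
    · exact Finset.analyticAt_fun_sum _ fun i hi => (he _).div (he _) (hp i (by simpa using hi))
  · exact AnalyticAt.pi fun i => ((h3' i).mul (he _)).sub analyticAt_fst

theorem cp_fst {E F : Type} [NormedAddCommGroup E] [NormedSpace ℝ E] [NormedAddCommGroup F]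
    [NormedSpace ℝ F] (h : ℝ → E × F) (hh : HasDerivAt h 0 0) :
    HasDerivAt (fun t => (h t).1) 0 0 := by
  have := (ContinuousLinearMap.fst ℝ E F).hasFDerivAt.comp_hasDerivAt (0 : ℝ) hh
  rw [map_zero] at this
  exact this

theorem cp_snd {E F : Type} [NormedAddCommGroup E] [NormedSpace ℝ E] [NormedAddCommGroup F]
    [NormedSpace ℝ F] (h : ℝ → E × F) (hh : HasDerivAt h 0 0) :
    HasDerivAt (fun t => (h t).2) 0 0 := by
  have := (ContinuousLinearMap.snd ℝ E F).hasFDerivAt.comp_hasDerivAt (0 : ℝ) hh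
  rw [map_zero] at this
  exact this

theorem cp_inj {n r : ℕ} (f : MvPolynomial (Fin n) ℝ)
    (g : Fin r → MvPolynomial (Fin n) ℝ) (xb : Fin n → ℝ)
    (I : Finset (Fin r))
    (hI0 : ∀ i ∈ I, eval xb (g i) = 0)
    (hIpos : ∀ i ∉ I, 0 < eval xb (g i))
    (ub : {i // i ∈ I} → ℝ) (hupos : ∀ i, 0 < ub i)
    (hnd : kktDet f (fun i : {i // i ∈ I} => g i.1) xb ub ≠ 0)
    (d : ℝ × (Fin n → ℝ) × ({i // i ∈ I} → ℝ))
    (hd : fderiv ℝ (cpPhi f g I) ((0 : ℝ), xb, ub) d = 0) : d = 0 := by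
  obtain ⟨dm, dx, du⟩ := d
  set p0 : ℝ × (Fin n → ℝ) × ({i // i ∈ I} → ℝ) := ((0 : ℝ), xb, ub) with hp0
  have hF : HasFDerivAt (cpPhi f g I) (fderiv ℝ (cpPhi f g I) p0) p0 :=
    (cp_analyticAt f g I p0 fun i hi => (hIpos i hi).ne').differentiableAt.hasFDerivAt
  have hl : HasDerivAt (fun t : ℝ => p0 + t • (dm, dx, du)) (dm, dx, du) 0 := by
    simpa using ((hasDerivAt_id (0 : ℝ)).smul_const (dm, dx, du)).const_add p0
  have hc : HasDerivAt (fun t : ℝ => cpPhi f g I (p0 + t • (dm, dx, du))) 0 0 := by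
    have h := HasFDerivAt.comp_hasDerivAt_of_eq (0 : ℝ) hF hl (by simp)
    rw [hd] at h
    exact h
  have h1 : HasDerivAt (fun t : ℝ => (cpPhi f g I (p0 + t • (dm, dx, du))).1) 0 0 := 
    cp_fst _ hc
  have h2 : HasDerivAt (fun t : ℝ => (cpPhi f g I (p0 + t • (dm, dx, du))).2) 0 0 := 
    cp_snd _ hc
  have h21 : HasDerivAt (fun t : ℝ => (cpPhi f g I (p0 + t • (dm, dx, du))).2.1) 0 0 := 
    cp_fst _ h2
  have h22 : HasDerivAt (fun t : ℝ => (cpPhi f g I (p0 + t • (dm, dx, du))).2.2) 0 0 := 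
    cp_snd _ h2
  have hdm : dm = 0 := by
    refine HasDerivAt.unique (f := fun t : ℝ => 0 + t * dm) (x := 0) ?_ h1
    simpa using ((hasDerivAt_id (0 : ℝ)).mul_const dm)
  subst hdm
  rw [hasDerivAt_pi] at h21 h22
  have hu : ∀ i, HasDerivAt (fun t : ℝ => ub i + t * du i) (du i) 0 := fun i => by
    simpa using ((hasDerivAt_id (0 : ℝ)).mul_const (du i)).const_add (ub i)
  have e2 : ∀ i : {i // i ∈ I}, ∑ k, dx k * eval xb (pderiv k (g i.1)) = 0 := fun i => by
    have h := ((hu i).mul (cp_hasDerivAt_eval (g i.1) xb dx)).unique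
      ((h22 i).congr_of_eventuallyEq (Filter.Eventually.of_forall fun t => by
        simp [cpPhi, hp0]))
    have h' := (hupos i).ne'
    simp only [zero_smul, add_zero, zero_mul, hI0 i.1 i.2, mul_zero, zero_add, Pi.zero_apply,
      mul_eq_zero, h', false_or] at h
    exact h
  have e1 : ∀ j, ∑ k, dx k * eval xb (pderiv k (pderiv j f)) -
      ∑ i : {i // i ∈ I}, (du i * eval xb (pderiv j (g i.1)) +
        ub i * ∑ k, dx k * eval xb (pderiv k (pderiv j (g i.1)))) = 0 := fun j => by
    have h := ((cp_hasDerivAt_eval (pderiv j f) xb dx).sub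
      (HasDerivAt.fun_sum (u := Finset.univ) fun i _ =>
        (hu i).mul (cp_hasDerivAt_eval (pderiv j (g i.1)) xb dx))).unique
      ((h21 j).congr_of_eventuallyEq (Filter.Eventually.of_forall fun t => by
        simp [cpPhi, hp0]))
    simpa using h
  have hz : Sum.elim dx du = 0 := by
    refine Matrix.eq_zero_of_mulVec_eq_zero hnd ?_
    rw [Matrix.fromBlocks_mulVec]
    funext s
    rcases s with j | i
    · have := e1 j
      simp only [Sum.elim_inl, Sum.elim_comp_inl, Sum.elim_comp_inr, Pi.add_apply, Matrix.mulVec,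
        dotProduct, Matrix.of_apply, Pi.zero_apply, sub_mul, Finset.sum_sub_distrib, neg_mul,
        Finset.sum_neg_distrib, Finset.sum_mul]
      rw [← this, Finset.sum_add_distrib, Finset.sum_comm]
      simp only [Finset.mul_sum, mul_comm, mul_left_comm]
      ring
    · have := e2 i
      simp only [Sum.elim_inr, Sum.elim_comp_inl, Sum.elim_comp_inr, Pi.add_apply, Matrix.mulVec,
        dotProduct, Matrix.of_apply, Pi.zero_apply, Matrix.zero_apply, zero_mul,
        Finset.sum_const_zero, add_zero]
      rw [← this]
      exact Finset.sum_congr rfl fun k _ => mul_comm _ _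
  have hx : dx = 0 := funext fun j => congrFun hz (Sum.inl j)
  have hu0 : du = 0 := funext fun j => congrFun hz (Sum.inr j)
  rw [hx, hu0]; rfl

theorem cp_solves {n r : ℕ} (f : MvPolynomial (Fin n) ℝ)
    (g : Fin r → MvPolynomial (Fin n) ℝ) (I : Finset (Fin r)) (m : ℝ) (y : Fin n → ℝ)
    (hg : ∀ i ∈ I, eval y (g i) ≠ 0) :
    cpPhi f g I (m, y, fun i => m / eval y (g i.1)) = (m, 0, 0) ↔
    ∀ j, eval y (pderiv j f) = m * ∑ i, eval y (pderiv j (g i)) / eval y (g i) := by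
  have key : ∀ j, m * ∑ i, eval y (pderiv j (g i)) / eval y (g i) =
      ∑ i : {i // i ∈ I}, m / eval y (g i.1) * eval y (pderiv j (g i.1)) +
      m * ∑ i ∈ Iᶜ, eval y (pderiv j (g i)) / eval y (g i) := fun j => by
    rw [← Finset.sum_add_sum_compl I, mul_add, ← Finset.sum_coe_sort I, Finset.mul_sum]
    congr 1
    exact Finset.sum_congr rfl fun i _ => by ring
  simp only [cpPhi, Prod.mk.injEq, true_and]
  constructor
  · rintro ⟨h, -⟩ j
    have := congrFun h j
    simp only [Pi.zero_apply] at this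
    rw [key]; linarith
  · intro h
    refine ⟨funext fun j => ?_, funext fun i => ?_⟩
    · have := h j
      rw [key] at this
      simp only [Pi.zero_apply]; linarith
    · have := hg i.1 i.2
      simp only [Pi.zero_apply]
      field_simp
      simp

/-- Under the stated non-degeneracy and positivity conditions at `x̄`, a
critical path `x(μ)` of the log-barrier function exists, consists of isolated critical points,
is real-analytic on `(0,μ_0)`, and extends analytically through `μ = 0` with value `x̄`. -/
theorem critical_path_exists_and_analytic (n r : ℕ) (f : MvPolynomial (Fin n) ℝ)
    (g : Fin r → MvPolynomial (Fin n) ℝ) (xb : Fin n → ℝ)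
    (I : Finset (Fin r)) (hIne : I.Nonempty)
    (hI0 : ∀ i ∈ I, eval xb (g i) = 0)
    (hIpos : ∀ i ∉ I, 0 < eval xb (g i))
    (hli : LinearIndependent ℝ
      (fun i : {i // i ∈ I} => (fun j => eval xb (pderiv j (g i.1)) : Fin n → ℝ)))
    (ub : {i // i ∈ I} → ℝ) (hupos : ∀ i, 0 < ub i)
    (hgrad : ∀ j, eval xb (pderiv j f) =
      ∑ i : {i // i ∈ I}, ub i * eval xb (pderiv j (g i.1)))
    (hnd : kktDet f (fun i : {i // i ∈ I} => g i.1) xb ub ≠ 0) :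
    ∃ μ0 > (0 : ℝ), ∃ x : ℝ → Fin n → ℝ,
      AnalyticOnNhd ℝ x (Set.Ioo 0 μ0) ∧
      (∀ μ ∈ Set.Ioo (0 : ℝ) μ0,
        (∀ i, 0 < eval (x μ) (g i)) ∧
        (∀ j, eval (x μ) (pderiv j f) =
          μ * ∑ i, eval (x μ) (pderiv j (g i)) / eval (x μ) (g i)) ∧
        ∃ δ > (0 : ℝ), ∀ y : Fin n → ℝ,
          ((∀ i, 0 < eval y (g i)) ∧
            ∀ j, eval y (pderiv j f) = μ * ∑ i, eval y (pderiv j (g i)) / eval y (g i)) →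
          dist y (x μ) < δ → y = x μ) ∧
      ∃ ε : ℝ, 0 < ε ∧ ε ≤ μ0 ∧ ∃ y : ℝ → Fin n → ℝ,
        AnalyticAt ℝ y 0 ∧ (∀ μ ∈ Set.Ioo (0 : ℝ) ε, y μ = x μ) ∧ y 0 = xb := by
  classical
  set p0 : ℝ × (Fin n → ℝ) × ({i // i ∈ I} → ℝ) := ((0 : ℝ), xb, ub) with hp0
  have hA : AnalyticAt ℝ (cpPhi f g I) p0 :=
    cp_analyticAt f g I p0 fun i hi => (hIpos i hi).ne'
  have hinj := cp_inj f g xb I hI0 hIpos ub hupos hnd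
  have hPhi0 : cpPhi f g I p0 = (0, 0, 0) := by
    simp only [cpPhi, hp0, Prod.mk.injEq, true_and]
    refine ⟨funext fun j => ?_, funext fun i => ?_⟩
    · simp [hgrad j]
    · simp [hI0 i.1 i.2]
  obtain ⟨L, hL⟩ : ∃ L : (ℝ × (Fin n → ℝ) × ({i // i ∈ I} → ℝ)) ≃L[ℝ]
      (ℝ × (Fin n → ℝ) × ({i // i ∈ I} → ℝ)),
      (L : _ →L[ℝ] _) = fderiv ℝ (cpPhi f g I) p0 := by
    let l := LinearEquiv.ofInjectiveEndo
      (fderiv ℝ (cpPhi f g I) p0).toLinearMap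
      ((injective_iff_map_eq_zero _).2 hinj)
    exact ⟨l.toContinuousLinearEquiv, ContinuousLinearMap.ext fun v => rfl⟩
  have hS : HasStrictFDerivAt (cpPhi f g I) (L : _ →L[ℝ] _) p0 := by
    rw [hL]; exact hA.hasStrictFDerivAt
  let e := hS.toOpenPartialHomeomorph (cpPhi f g I)
  have hecoe : ∀ p, e p = cpPhi f g I p := fun p => rfl
  have hsrc : p0 ∈ e.source := hS.mem_toOpenPartialHomeomorph_source
  have hsymmA : AnalyticAt ℝ e.symm (0, 0, 0) := by
    have := e.analyticAt_symm' hsrc hA hL.symm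
    rwa [hecoe, hPhi0] at this
  have hsymm0 : e.symm (0, 0, 0) = p0 := by
    rw [← hPhi0]; exact e.left_inv hsrc
  have htgt : ((0, 0, 0) : ℝ × (Fin n → ℝ) × ({i // i ∈ I} → ℝ)) ∈ e.target := by
    rw [← hPhi0]; exact e.map_source hsrc
  let w : ℝ → ℝ × (Fin n → ℝ) × ({i // i ∈ I} → ℝ) := fun m => e.symm (m, 0, 0)
  have hw0 : w 0 = p0 := hsymm0
  have hwA : AnalyticAt ℝ w 0 := by
    have h : AnalyticAt ℝ (fun m : ℝ =>
        ((m, 0, 0) : ℝ × (Fin n → ℝ) × ({i // i ∈ I} → ℝ))) 0 :=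
      analyticAt_id.prod analyticAt_const
    exact AnalyticAt.comp (g := e.symm) hsymmA h
  have hxA : AnalyticAt ℝ (fun m => (w m).2.1) 0 :=
    analyticAt_fst.comp (analyticAt_snd.comp hwA)
  have hwc := hwA.continuousAt
  have hcx : ContinuousAt (fun m => (w m).2.1) 0 := hxA.continuousAt
  have hcu : ∀ i, ContinuousAt (fun m => (w m).2.2 i) 0 := fun i =>
    (continuousAt_pi.1 hwc.snd.snd) i
  have hev : ∀ q : MvPolynomial (Fin n) ℝ, Continuous fun x : Fin n → ℝ => eval x q :=
    fun q => MvPolynomial.continuous_eval q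
  have E1 : ∀ᶠ m in nhds (0 : ℝ), AnalyticAt ℝ (fun m => (w m).2.1) m :=
    hxA.eventually_analyticAt
  have E2 : ∀ᶠ m in nhds (0 : ℝ), ((m, 0, 0) : ℝ × (Fin n → ℝ) × ({i // i ∈ I} → ℝ)) ∈ e.target :=
    ContinuousAt.eventually_mem (f := fun m : ℝ =>
      ((m, 0, 0) : ℝ × (Fin n → ℝ) × ({i // i ∈ I} → ℝ))) (by fun_prop)
      (e.open_target.mem_nhds htgt)
  have E3 : ∀ᶠ m in nhds (0 : ℝ), ∀ i, 0 < (w m).2.2 i :=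
    Filter.eventually_all.2 fun i => (hcu i).eventually (lt_mem_nhds (by
      show 0 < (w 0).2.2 i
      rw [hw0]; exact hupos i))
  have E4 : ∀ᶠ m in nhds (0 : ℝ), ∀ i, i ∉ I → 0 < eval (w m).2.1 (g i) :=
    Filter.eventually_all.2 fun i => by
      by_cases hi : i ∈ I
      · exact Filter.Eventually.of_forall fun m h => absurd hi h
      · have hc : ContinuousAt (fun m => eval (w m).2.1 (g i)) 0 :=
          ContinuousAt.comp (g := fun x => eval x (g i)) (hev (g i)).continuousAt hcx
        refine (hc.eventually (lt_mem_nhds (a := 0) ?_)).mono fun m h _ => h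
        show 0 < eval (w 0).2.1 (g i)
        rw [hw0]; exact hIpos i hi
  obtain ⟨μ0, hμ0, hball⟩ := Metric.eventually_nhds_iff.1 (E1.and (E2.and (E3.and E4)))
  have hall : ∀ m ∈ Set.Ioo (0 : ℝ) μ0, _ := fun m hm => hball (y := m) (by
    rw [Real.dist_eq, sub_zero, abs_of_pos hm.1]; exact hm.2)
  refine ⟨μ0, hμ0, fun m => (w m).2.1, fun m hm => (hall m hm).1, fun m hm => ?_,
    μ0, hμ0, le_rfl, fun m => (w m).2.1, hxA, fun _ _ => rfl, congrArg (fun q => q.2.1) hw0⟩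
  obtain ⟨-, ht, hu, hg⟩ := hall m hm
  have hwm : cpPhi f g I (w m) = (m, 0, 0) := e.right_inv ht
  have hws : w m ∈ e.source := e.map_target ht
  have hw1 : (w m).1 = m := congrArg Prod.fst hwm
  have hug : ∀ i : {i // i ∈ I}, (w m).2.2 i * eval (w m).2.1 (g i.1) = m := fun i => by
    have := congrFun (congrArg (fun q => q.2.2) hwm) i
    simp only [cpPhi, hw1, Pi.zero_apply] at this
    linarith
  have hgpos : ∀ i, 0 < eval (w m).2.1 (g i) := fun i => by
    by_cases hi : i ∈ I
    · have h1 := hug ⟨i, hi⟩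
      have h2 := hu ⟨i, hi⟩
      exact pos_of_mul_pos_right (by rw [h1]; exact hm.1) h2.le
    · exact hg i hi
  have hweq : w m = (m, (w m).2.1, fun i => m / eval (w m).2.1 (g i.1)) := by
    refine Prod.ext hw1 (Prod.ext rfl (funext fun i => ?_))
    exact (eq_div_iff (hgpos i.1).ne').2 (hug i)
  refine ⟨hgpos, ?_, ?_⟩
  · refine (cp_solves f g I m _ fun i _ => (hgpos i).ne').1 ?_
    rw [← hweq]; exact hwm
  · have hc : ContinuousAt (fun y : Fin n → ℝ =>
        ((m, y, fun i => m / eval y (g i.1)) : ℝ × (Fin n → ℝ) × ({i // i ∈ I} → ℝ)))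
        (w m).2.1 := by
      refine continuousAt_const.prodMk (continuousAt_id.prodMk (continuousAt_pi.2 fun i => ?_))
      exact continuousAt_const.div (hev _).continuousAt (hgpos i.1).ne'
    have hn := hc.eventually_mem (e.open_source.mem_nhds (by rw [← hweq]; exact hws))
    obtain ⟨δ, hδ, hδb⟩ := Metric.eventually_nhds_iff.1 hn
    refine ⟨δ, hδ, fun y hy hd => ?_⟩
    have hys := hδb hd
    have hyP := (cp_solves f g I m y fun i _ => (hy.1 i).ne').2 hy.2
    have := e.injOn hys hws (by rw [hecoe, hecoe, hyP, hwm])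
    exact congrArg (fun q => q.2.1) this
end
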